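/- arXiv:2202.10198 — 3 statements merged into one kernel-verified Lean document; each statement's English description precedes it below -/
import Mathlib

section
/- Let (X, d) be a compact metric space, G a group acting on X by homeomorphisms via α, ε > 0, and F₁, F₂ nonempty finite subsets of G. Then widim_ε(X, d^α_{F₁ ∪ F₂}) ≤ widim_ε(X, d^α_{F₁}) + widim_ε(X, d^α_{F₂}), and widim_ε(X, d^α_{Fg}) = widim_ε(X, d^α_F) for every g ∈ G, where d^α_F(x,y) = max_{g∈F} d(α_g(x), α_g(y)). -/
open scoped Pointwise ENNReal

/-- An action of a group `G` on a set `X`. -/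
structure GAction (G X : Type*) [Group G] where
  act : G → X → X
  act_one : ∀ x, act 1 x = x
  act_mul : ∀ g h x, act (g * h) x = act g (act h x)

/-- The dynamical sup-metric `d^α_F(x,y) = max_{g ∈ F} d(α_g x, α_g y)`. -/
noncomputable def dynMetric {G X : Type*} [Group G] (α : GAction G X)
    (d : X → X → ℝ) (F : Finset G) (x y : X) : ℝ :=
  ↑(F.sup fun g => (d (α.act g x) (α.act g y)).toNNReal)

/-- `widim_ε(X, d)`: minimal order of a finite open cover of mesh at most `ε`. -/
noncomputable def widim {X : Type*} [TopologicalSpace X] (d : X → X → ℝ) (ε : ℝ) : ℕ :=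
  sInf {n : ℕ | ∃ 𝒰 : Finset (Set X),
    (∀ U ∈ 𝒰, IsOpen U) ∧ (∀ x : X, ∃ U ∈ 𝒰, x ∈ U) ∧
    (∀ U ∈ 𝒰, ∀ x ∈ U, ∀ y ∈ U, d x y ≤ ε) ∧
    ∀ x : X, {U : Set X | U ∈ 𝒰 ∧ x ∈ U}.ncard ≤ n + 1}

/-- `F` is `(K, δ)`-invariant: `|KF \ F| ≤ δ |F|`. -/
def IsFolnerInv {G : Type*} [Group G] (K : Finset G) (δ : ℝ) (F : Finset G) : Prop :=
  letI := Classical.decEq G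
  (((K * F) \ F).card : ℝ) ≤ δ * F.card

/-- A Følner sequence of nonempty finite subsets of `G`. -/
def IsFolnerSeq {G : Type*} [Group G] (Fseq : ℕ → Finset G) : Prop :=
  (∀ n, (Fseq n).Nonempty) ∧
    ∀ (K : Finset G) (δ : ℝ), 0 < δ → ∃ N : ℕ, ∀ n ≥ N, IsFolnerInv K δ (Fseq n)

/-- `mdim_ε(X, α, d)` computed along the sequence `Fseq`. -/
noncomputable def mdimEps {G X : Type*} [Group G] [TopologicalSpace X] (α : GAction G X)
    (d : X → X → ℝ) (Fseq : ℕ → Finset G) (ε : ℝ) : ℝ≥0∞ :=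
  Filter.atTop.limsup fun n =>
    (widim (dynMetric α d (Fseq n)) ε : ℝ≥0∞) / ((Fseq n).card : ℝ≥0∞)

/-- Mean dimension `mdim(X, α) = sup_{ε > 0} mdim_ε(X, α, d)`. -/
noncomputable def mdim {G X : Type*} [Group G] [TopologicalSpace X] (α : GAction G X)
    (d : X → X → ℝ) (Fseq : ℕ → Finset G) : ℝ≥0∞ :=
  ⨆ (ε : ℝ) (_ : 0 < ε), mdimEps α d Fseq ε

/-- An `ε`-embedding: all fibers have diameter `< ε`. -/
def IsEpsEmbedding {X Z : Type*} [PseudoMetricSpace X] (f : X → Z) (ε : ℝ) : Prop :=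
  ∀ z : Z, Metric.diam (f ⁻¹' {z}) < ε

/-- The orbit map `I_f(x) = (f(α_g(x)))_{g ∈ G}` (with the index convention making it
equivariant for the shift `σ_g((x_h)_h) = (x_{g⁻¹h})_h`). -/
def Ifun {G X K : Type*} [Group G] (α : GAction G X) (f : X → K) (x : X) (g : G) : K :=
  f (α.act g⁻¹ x)

/-- Almost finiteness: clopen castles with arbitrarily invariant shapes partitioning the space. -/
def IsAlmostFinite {G Y : Type*} [Group G] [TopologicalSpace Y] (β : GAction G Y) : Prop :=
  ∀ (K : Finset G) (δ : ℝ), 0 < δ →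
    ∃ (ι : Type) (_ : Fintype ι) (W : ι → Set Y) (S : ι → Finset G),
      (∀ i, IsClopen (W i)) ∧
      (∀ i, (S i).Nonempty ∧ IsFolnerInv K δ (S i)) ∧
      (∀ i j : ι, ∀ s ∈ S i, ∀ t ∈ S j, ¬(i = j ∧ s = t) →
        Disjoint (β.act s '' W i) (β.act t '' W j)) ∧
      (⋃ i, ⋃ s ∈ S i, β.act s '' W i) = Set.univ

/-- `d` is a metric on `X` inducing the given topology. -/
def IsCompatibleMetric {X : Type*} [TopologicalSpace X] (d : X → X → ℝ) : Prop :=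
  (∀ x y, 0 ≤ d x y) ∧ (∀ x y, d x y = 0 ↔ x = y) ∧ (∀ x y, d x y = d y x) ∧
    (∀ x y z, d x z ≤ d x y + d y z) ∧
    ∀ s : Set X, IsOpen s ↔ ∀ x ∈ s, ∃ ε > 0, {y | d x y < ε} ⊆ s

/-- The shift action `σ_g((x_h)_h) = (x_{g⁻¹h})_h` of `G` on `K^G`. -/
def shiftAction (G : Type*) [Group G] (K : Type*) : GAction G (G → K) where
  act g x h := x (g⁻¹ * h)
  act_one x := by funext h; simp
  act_mul g g' x := by funext h; simp [mul_assoc]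

/-- The set whose infimum is `widim`. -/
def widimSet {X : Type*} [TopologicalSpace X] (d : X → X → ℝ) (ε : ℝ) : Set ℕ :=
  {n : ℕ | ∃ 𝒰 : Finset (Set X),
    (∀ U ∈ 𝒰, IsOpen U) ∧ (∀ x : X, ∃ U ∈ 𝒰, x ∈ U) ∧
    (∀ U ∈ 𝒰, ∀ x ∈ U, ∀ y ∈ U, d x y ≤ ε) ∧
    ∀ x : X, {U : Set X | U ∈ 𝒰 ∧ x ∈ U}.ncard ≤ n + 1}

lemma dynMetric_le_iff {G X : Type*} [Group G] [MetricSpace X] (α : GAction G X)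
    (F : Finset G) (x y : X) {ε : ℝ} (hε : 0 < ε) :
    dynMetric α dist F x y ≤ ε ↔ ∀ g ∈ F, dist (α.act g x) (α.act g y) ≤ ε := by
  unfold dynMetric
  lift ε to NNReal using hε.le
  rw [NNReal.coe_le_coe, Finset.sup_le_iff]
  simp [Real.toNNReal_le_iff_le_coe]

lemma widimSet_nonempty {G X : Type*} [Group G] [MetricSpace X] [CompactSpace X]
    (α : GAction G X) (hα : ∀ g, Continuous (α.act g)) (ε : ℝ) (hε : 0 < ε) (F : Finset G) :
    (widimSet (dynMetric α dist F) ε).Nonempty := by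
  classical
  let N : X → Set X := fun x => {y | ∀ g ∈ F, dist (α.act g y) (α.act g x) < ε / 2}
  have hN : ∀ x, IsOpen (N x) := by
    intro x
    have : N x = ⋂ g ∈ F, {y | dist (α.act g y) (α.act g x) < ε / 2} := by
      ext y; simp [N]
    rw [this]
    refine isOpen_biInter_finset fun g _ => ?_
    exact isOpen_lt ((hα g).dist continuous_const) continuous_const
  have hx : ∀ x, x ∈ N x := by
    intro x g _
    simp only [dist_self]; linarith
  obtain ⟨t, ht⟩ := isCompact_univ.elim_finite_subcover N hN
    (fun x _ => Set.mem_iUnion.2 ⟨x, hx x⟩)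
  refine ⟨(t.image N).card, t.image N, ?_, ?_, ?_, ?_⟩
  · intro U hU
    obtain ⟨x, _, rfl⟩ := Finset.mem_image.1 hU
    exact hN x
  · intro x
    obtain ⟨y, hy, hxy⟩ := Set.mem_iUnion₂.1 (ht (Set.mem_univ x))
    exact ⟨N y, Finset.mem_image_of_mem _ hy, hxy⟩
  · intro U hU x hx y hy
    obtain ⟨z, _, rfl⟩ := Finset.mem_image.1 hU
    rw [dynMetric_le_iff α F x y hε]
    intro g hg
    have h1 := hx g hg
    have h2 := hy g hg
    have h3 := dist_triangle_right (α.act g x) (α.act g y) (α.act g z)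
    linarith
  · intro x
    have : {U : Set X | U ∈ t.image N ∧ x ∈ U} ⊆ ((t.image N : Finset (Set X)) : Set (Set X)) :=
      fun U hU => hU.1
    have h := Set.ncard_le_ncard this (Finset.finite_toSet _)
    rw [Set.ncard_coe_finset] at h
    omega

lemma widimSet_pullback {X : Type*} [TopologicalSpace X] (d d' : X → X → ℝ) (ε : ℝ)
    (φ : X → X) (hφ : Continuous φ) (h : ∀ x y, d' x y = d (φ x) (φ y)) :
    widimSet d ε ⊆ widimSet d' ε := by
  classical
  rintro n ⟨𝒰, ho, hc, hm, hn⟩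
  refine ⟨𝒰.image (fun U => φ ⁻¹' U), ?_, ?_, ?_, ?_⟩
  · intro V hV
    obtain ⟨U, hU, rfl⟩ := Finset.mem_image.1 hV
    exact (ho U hU).preimage hφ
  · intro x
    obtain ⟨U, hU, hx⟩ := hc (φ x)
    exact ⟨_, Finset.mem_image_of_mem _ hU, hx⟩
  · intro V hV x hx y hy
    obtain ⟨U, hU, rfl⟩ := Finset.mem_image.1 hV
    rw [h]
    exact hm U hU _ hx _ hy
  · intro x
    have hf : {U : Set X | U ∈ 𝒰 ∧ φ x ∈ U}.Finite :=
      (Finset.finite_toSet 𝒰).subset fun U hU => hU.1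
    have hs : {V : Set X | V ∈ 𝒰.image (fun U => φ ⁻¹' U) ∧ x ∈ V} ⊆
        (fun U => φ ⁻¹' U) '' {U : Set X | U ∈ 𝒰 ∧ φ x ∈ U} := by
      rintro V ⟨hV, hx⟩
      obtain ⟨U, hU, rfl⟩ := Finset.mem_image.1 hV
      exact ⟨U, ⟨hU, hx⟩, rfl⟩
    exact (Set.ncard_le_ncard hs (hf.image _)).trans ((Set.ncard_image_le hf).trans (hn (φ x)))

lemma widimSet_join {X : Type*} [MetricSpace X] (d₁ d₂ d : X → X → ℝ) (ε : ℝ)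
    (h : ∀ x y, d₁ x y ≤ ε → d₂ x y ≤ ε → d x y ≤ ε) {m n : ℕ}
    (hm : m ∈ widimSet d₁ ε) (hn : n ∈ widimSet d₂ ε) : m + n ∈ widimSet d ε := by
  classical
  obtain ⟨𝒰, ho, hc, hd, ht⟩ := hm
  obtain ⟨𝒱, ho', hc', hd', ht'⟩ := hn
  let s : Set X ⊕ Set X → Set X := Sum.elim id id
  let f : Set X ⊕ Set X → X → ENNReal := fun i x => Metric.infEDist x (s i)ᶜ
  have hfc : ∀ i, Continuous (f i) := fun i => Metric.continuous_infEDist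
  let I := 𝒰.disjSum 𝒱
  have hso : ∀ i ∈ I, IsOpen (s i) := by
    rintro (U | V) hi
    · exact ho U (Finset.inl_mem_disjSum.1 hi)
    · exact ho' V (Finset.inr_mem_disjSum.1 hi)
  have hpos : ∀ i ∈ I, ∀ x, 0 < f i x ↔ x ∈ s i := by
    intro i hi x
    have := Metric.mem_iff_infEDist_zero_of_closed (x := x) (hso i hi).isClosed_compl
    rw [pos_iff_ne_zero, Ne, ← this, Set.mem_compl_iff, not_not]
  let W : Finset (Set X ⊕ Set X) → Set X := fun A =>
    {x | ∀ i ∈ A, 0 < f i x ∧ ∀ j ∈ I \ A, f j x < f i x}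
  have hWo : ∀ A, IsOpen (W A) := by
    intro A
    have : W A = ⋂ i ∈ A, ({x | 0 < f i x} ∩ ⋂ j ∈ I \ A, {x | f j x < f i x}) := by
      ext x
      simp only [W, Set.mem_setOf_eq, Set.mem_iInter, Set.mem_inter_iff]
    rw [this]
    refine isOpen_biInter_finset fun i _ => IsOpen.inter ?_ (isOpen_biInter_finset fun j _ => ?_)
    · exact isOpen_lt continuous_const (hfc i)
    · exact isOpen_lt (hfc j) (hfc i)
  let P : Finset (Finset (Set X ⊕ Set X)) :=
    I.powerset.filter fun A => (∃ U, Sum.inl U ∈ A) ∧ (∃ V, Sum.inr V ∈ A)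
  refine ⟨P.image W, ?_, ?_, ?_, ?_⟩
  · intro U hU
    obtain ⟨A, _, rfl⟩ := Finset.mem_image.1 hU
    exact hWo A
  · intro x
    obtain ⟨U, hU, hxU⟩ := hc x
    obtain ⟨V, hV, hxV⟩ := hc' x
    have hUI : Sum.inl U ∈ I := Finset.inl_mem_disjSum.2 hU
    have hVI : Sum.inr V ∈ I := Finset.inr_mem_disjSum.2 hV
    refine ⟨W (I.filter fun i => 0 < f i x), Finset.mem_image_of_mem _ ?_, ?_⟩
    · refine Finset.mem_filter.2 ⟨Finset.mem_powerset.2 (Finset.filter_subset _ _), ⟨U, ?_⟩, ⟨V, ?_⟩⟩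
      · exact Finset.mem_filter.2 ⟨hUI, (hpos _ hUI x).2 hxU⟩
      · exact Finset.mem_filter.2 ⟨hVI, (hpos _ hVI x).2 hxV⟩
    · intro i hi
      have hi' := (Finset.mem_filter.1 hi).2
      refine ⟨hi', fun j hj => ?_⟩
      rw [Finset.mem_sdiff, Finset.mem_filter, not_and] at hj
      exact lt_of_le_of_lt (not_lt.1 (hj.2 hj.1)) hi'
  · intro T hT x hx y hy
    obtain ⟨A, hA, rfl⟩ := Finset.mem_image.1 hT
    obtain ⟨hAI, ⟨U, hU⟩, ⟨V, hV⟩⟩ := Finset.mem_filter.1 hA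
    have hAI := Finset.mem_powerset.1 hAI
    refine h x y ?_ ?_
    · exact hd U (Finset.inl_mem_disjSum.1 (hAI hU)) x ((hpos _ (hAI hU) x).1 (hx _ hU).1)
        y ((hpos _ (hAI hU) y).1 (hy _ hU).1)
    · exact hd' V (Finset.inr_mem_disjSum.1 (hAI hV)) x ((hpos _ (hAI hV) x).1 (hx _ hV).1)
        y ((hpos _ (hAI hV) y).1 (hy _ hV).1)
  · intro x
    let Q := P.filter fun A => x ∈ W A
    have hs : {T : Set X | T ∈ P.image W ∧ x ∈ T} ⊆ ((Q.image W : Finset (Set X)) : Set (Set X)) := by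
      rintro T ⟨hT, hx⟩
      obtain ⟨A, hA, rfl⟩ := Finset.mem_image.1 hT
      exact Finset.mem_coe.2 (Finset.mem_image_of_mem _ (Finset.mem_filter.2 ⟨hA, hx⟩))
    have h1 := Set.ncard_le_ncard hs (Finset.finite_toSet _)
    rw [Set.ncard_coe_finset] at h1
    have h2 : (Q.image W).card ≤ Q.card := Finset.card_image_le
    have h3 : Q.card ≤ (Finset.Icc 2 (m + n + 2)).card := by
      refine Finset.card_le_card_of_injOn Finset.card ?_ ?_
      · intro A hA
        obtain ⟨hAP, hxA⟩ := Finset.mem_filter.1 (Finset.mem_coe.1 hA)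
        obtain ⟨hAI, ⟨U, hU⟩, ⟨V, hV⟩⟩ := Finset.mem_filter.1 hAP
        have hAI := Finset.mem_powerset.1 hAI
        refine Finset.mem_coe.2 (Finset.mem_Icc.2 ⟨?_, ?_⟩)
        · exact Finset.one_lt_card.2 ⟨_, hU, _, hV, by simp⟩
        · have hsub : A ⊆ (𝒰.filter fun U => x ∈ U).disjSum (𝒱.filter fun V => x ∈ V) := by
            rintro (U | V) hi
            · exact Finset.inl_mem_disjSum.2 (Finset.mem_filter.2
                ⟨Finset.inl_mem_disjSum.1 (hAI hi), (hpos _ (hAI hi) x).1 (hxA _ hi).1⟩)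
            · exact Finset.inr_mem_disjSum.2 (Finset.mem_filter.2
                ⟨Finset.inr_mem_disjSum.1 (hAI hi), (hpos _ (hAI hi) x).1 (hxA _ hi).1⟩)
          have hcard := Finset.card_le_card hsub
          rw [Finset.card_disjSum] at hcard
          have e1 := ht x
          have e2 := ht' x
          rw [show {U : Set X | U ∈ 𝒰 ∧ x ∈ U} =
            ((𝒰.filter fun U => x ∈ U : Finset (Set X)) : Set (Set X)) by ext; simp,
            Set.ncard_coe_finset] at e1
          rw [show {U : Set X | U ∈ 𝒱 ∧ x ∈ U} =
            ((𝒱.filter fun U => x ∈ U : Finset (Set X)) : Set (Set X)) by ext; simp,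
            Set.ncard_coe_finset] at e2
          omega
      · intro A hA B hB hAB
        obtain ⟨hAP, hxA⟩ := Finset.mem_filter.1 (Finset.mem_coe.1 hA)
        obtain ⟨hBP, hxB⟩ := Finset.mem_filter.1 (Finset.mem_coe.1 hB)
        have hAI := Finset.mem_powerset.1 (Finset.mem_filter.1 hAP).1
        have hBI := Finset.mem_powerset.1 (Finset.mem_filter.1 hBP).1
        by_cases hsub : A ⊆ B
        · exact Finset.eq_of_subset_of_card_le hsub hAB.ge
        · obtain ⟨a, ha, hab⟩ := Finset.not_subset.1 hsub
          refine (Finset.eq_of_subset_of_card_le ?_ hAB.le).symm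
          intro b hb
          by_contra hba
          exact lt_asymm ((hxA a ha).2 b (Finset.mem_sdiff.2 ⟨hBI hb, hba⟩))
            ((hxB b hb).2 a (Finset.mem_sdiff.2 ⟨hAI ha, hab⟩))
    rw [Nat.card_Icc] at h3
    omega

theorem stmt4 {G X : Type*} [Group G] [DecidableEq G] [MetricSpace X] [CompactSpace X]
    (α : GAction G X) (hα : ∀ g, Continuous (α.act g))
    (ε : ℝ) (hε : 0 < ε) (F₁ F₂ : Finset G) (h1 : F₁.Nonempty) (h2 : F₂.Nonempty) :
    widim (dynMetric α dist (F₁ ∪ F₂)) ε ≤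
        widim (dynMetric α dist F₁) ε + widim (dynMetric α dist F₂) ε ∧
      ∀ g : G, widim (dynMetric α dist (F₁.image fun x => x * g)) ε
        = widim (dynMetric α dist F₁) ε := by
  constructor
  · have hm := Nat.sInf_mem (widimSet_nonempty α hα ε hε F₁)
    have hn := Nat.sInf_mem (widimSet_nonempty α hα ε hε F₂)
    refine Nat.sInf_le (widimSet_join _ _ (dynMetric α dist (F₁ ∪ F₂)) ε ?_ hm hn)
    intro x y h h'
    rw [dynMetric_le_iff _ _ _ _ hε] at *
    intro g hg
    rcases Finset.mem_union.1 hg with hg | hg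
    · exact h g hg
    · exact h' g hg
  · intro g
    have key : ∀ x y, dynMetric α dist (F₁.image fun x => x * g) x y =
        dynMetric α dist F₁ (α.act g x) (α.act g y) := by
      intro x y
      unfold dynMetric
      rw [Finset.sup_image]
      simp only [Function.comp_def, α.act_mul]
    have hinv : ∀ x, α.act g (α.act g⁻¹ x) = x := by
      intro x
      rw [← α.act_mul, mul_inv_cancel, α.act_one]
    have hset : widimSet (dynMetric α dist (F₁.image fun x => x * g)) ε =
        widimSet (dynMetric α dist F₁) ε := by
      refine Set.Subset.antisymm ?_ ?_
      · refine widimSet_pullback _ _ ε (α.act g⁻¹) (hα _) fun x y => ?_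
        rw [key, hinv, hinv]
      · exact widimSet_pullback _ _ ε (α.act g) (hα _) key
    exact congrArg sInf hset
end

section
/- Let G be a countable amenable group, α : G ↷ X an action on a compact metric space (X, d) with mdim(X, α) < m/2 for some m ≥ 1, and π : (X, α) → (Y, β) an equivariant continuous surjection onto an almost finite action β : G ↷ Y on a compact totally disconnected metrizable space. Then for every η > 0, the set A_η = { f ∈ C(X,[0,1]^m) : I_f × π is an η-embedding } is dense in C(X,[0,1]^m) with respect to the uniform norm, where I_f(x) = (f(α_g(x)))_{g∈G} ∈ ([0,1]^m)^G. -/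
open scoped Pointwise ENNReal

section OW
open Classical in
lemma inv_iff {G : Type*} [Group G] (K : Finset G) (δ : ℝ) (F : Finset G) :
    IsFolnerInv K δ F ↔ (((K * F) \ F).card : ℝ) ≤ δ * F.card := by
  unfold IsFolnerInv
  simp only

lemma inv_mono {G : Type*} [Group G] {K K' : Finset G} {δ δ' : ℝ} {F : Finset G}
    (hK : K ⊆ K') (hδ : δ' ≤ δ) (h : IsFolnerInv K' δ' F) : IsFolnerInv K δ F := by
  classical
  rw [inv_iff] at *
  have h1 : ((K * F) \ F).card ≤ ((K' * F) \ F).card :=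
    Finset.card_le_card (Finset.sdiff_subset_sdiff (Finset.mul_subset_mul_right hK) le_rfl)
  have h2 : (((K * F) \ F).card : ℝ) ≤ ((K' * F) \ F).card := by exact_mod_cast h1
  have h3 : δ' * (F.card : ℝ) ≤ δ * F.card := by gcongr
  linarith

open Classical in
lemma max_family {G : Type*} [Group G] (F D : Finset G) (e : ℝ) (he : 0 < e) (he1 : e < 1)
    (hF : F.Nonempty) :
    ∃ C ⊆ D, (1 - e) * F.card * C.card ≤ ((C.biUnion fun c => F.image (· * c)).card : ℝ) ∧
      ∀ c ∈ D, e * F.card ≤ ((F.image (· * c) ∩ C.biUnion fun c => F.image (· * c)).card : ℝ) := by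
  have hne : (D.powerset.filter fun C =>
      (1 - e) * F.card * C.card ≤ ((C.biUnion fun c => F.image (· * c)).card : ℝ)).Nonempty :=
    ⟨∅, by simp⟩
  obtain ⟨C, hC, hmax⟩ := Finset.exists_max_image _ Finset.card hne
  simp only [Finset.mem_filter, Finset.mem_powerset] at hC hmax
  refine ⟨C, hC.1, hC.2, fun c hc => ?_⟩
  by_contra hlt
  push Not at hlt
  have hcard : (F.image (· * c)).card = F.card :=
    Finset.card_image_of_injective _ (mul_left_injective c)
  have hFpos : (0 : ℝ) < F.card := by exact_mod_cast hF.card_pos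
  have hcC : c ∉ C := by
    intro hcC
    have : F.image (· * c) ∩ (C.biUnion fun c => F.image (· * c)) = F.image (· * c) :=
      Finset.inter_eq_left.2 (Finset.subset_biUnion_of_mem (fun c => F.image (· * c)) hcC)
    rw [this, hcard] at hlt
    nlinarith
  have := hmax (insert c C) ⟨Finset.insert_subset hc hC.1, ?_⟩
  · rw [Finset.card_insert_of_notMem hcC] at this
    omega
  · rw [Finset.biUnion_insert, Finset.card_insert_of_notMem hcC]
    have h1 := Finset.card_union_add_card_inter (F.image (· * c)) (C.biUnion fun c => F.image (· * c))
    rw [hcard] at h1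
    have h2 : (((F.image (· * c) ∪ C.biUnion fun c => F.image (· * c)).card : ℝ)) +
      (F.image (· * c) ∩ C.biUnion fun c => F.image (· * c)).card = F.card + (C.biUnion fun c => F.image (· * c)).card := by
      exact_mod_cast h1
    push_cast
    nlinarith [hC.2]

open Classical in
lemma cover_big {G : Type*} [Group G] (F D U : Finset G) (e : ℝ) (hF : F.Nonempty)
    (h : ∀ c ∈ D, e * F.card ≤ ((F.image (· * c) ∩ U).card : ℝ)) :
    e * D.card ≤ U.card := by
  have hFpos : (0 : ℝ) < F.card := by exact_mod_cast hF.card_pos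
  have h1 : ∑ c ∈ D, (F.image (· * c) ∩ U).card ≤ U.card * F.card := by
    have e1 : ∀ c ∈ D, (F.image (· * c) ∩ U).card = ∑ u ∈ U, if u ∈ F.image (· * c) then 1 else 0 := by
      intro c _
      rw [Finset.sum_ite_mem, Finset.inter_comm]; simp
    rw [Finset.sum_congr rfl e1, Finset.sum_comm]
    rw [← smul_eq_mul]
    apply Finset.sum_le_card_nsmul
    intro u _
    rw [← Finset.sum_filter, Finset.sum_const, smul_eq_mul, mul_one]
    refine (Finset.card_le_card (t := F.image (fun f => f⁻¹ * u)) ?_).trans Finset.card_image_le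
    intro c hc
    simp only [Finset.mem_filter, Finset.mem_image] at hc ⊢
    obtain ⟨_, f, hf, rfl⟩ := hc
    exact ⟨f, hf, by group⟩
  have h2 : (∑ c ∈ D, e * (F.card : ℝ)) ≤ ∑ c ∈ D, ((F.image (· * c) ∩ U).card : ℝ) :=
    Finset.sum_le_sum h
  have h3 : (∑ c ∈ D, ((F.image (· * c) ∩ U).card : ℝ)) ≤ U.card * F.card := by exact_mod_cast h1
  rw [Finset.sum_const, nsmul_eq_mul] at h2
  have h4 : (e * D.card) * (F.card : ℝ) ≤ U.card * F.card := by linarith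
  exact le_of_mul_le_mul_right h4 hFpos

open Classical in
lemma centers_big {G : Type*} [Group G] (F S : Finset G) (f₀ : G)
    (hinv : IsFolnerInv (F.image (· * f₀⁻¹)) (1 / (2 * F.card)) S) (hF : F.Nonempty) :
    ∃ D : Finset G, (∀ c ∈ D, F.image (· * c) ⊆ S) ∧ (S.card : ℝ) / 2 ≤ D.card := by
  have hFpos : (0 : ℝ) < F.card := by exact_mod_cast hF.card_pos
  rw [inv_iff] at hinv
  set K := F.image (· * f₀⁻¹)
  let B := S.filter fun s => ¬ (F.image (· * (f₀⁻¹ * s)) ⊆ S)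
  let A := S.filter fun s => (F.image (· * (f₀⁻¹ * s)) ⊆ S)
  have hAB : A.card + B.card = S.card := Finset.card_filter_add_card_filter_not _
  have hB : B.card ≤ F.card * ((K * S) \ S).card := by
    have : B ⊆ F.biUnion fun f => ((K * S) \ S).image fun t => f₀ * f⁻¹ * t := by
      intro s hs
      simp only [B, Finset.mem_filter, Finset.not_subset, Finset.mem_image] at hs
      obtain ⟨hs, x, ⟨f, hf, rfl⟩, hx⟩ := hs
      simp only [Finset.mem_biUnion, Finset.mem_image, Finset.mem_sdiff]
      refine ⟨f, hf, f * (f₀⁻¹ * s), ⟨?_, hx⟩, by group⟩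
      rw [← mul_assoc]
      exact Finset.mul_mem_mul (Finset.mem_image_of_mem _ hf) hs
    refine (Finset.card_le_card this).trans ?_
    exact Finset.card_biUnion_le_card_mul _ _ _ fun f _ => Finset.card_image_le
  refine ⟨A.image fun s => f₀⁻¹ * s, ?_, ?_⟩
  · intro c hc
    simp only [A, Finset.mem_image, Finset.mem_filter] at hc
    obtain ⟨s, hs, rfl⟩ := hc
    exact hs.2
  · rw [Finset.card_image_of_injective _ (mul_right_injective _)]
    have hB' : (B.card : ℝ) ≤ F.card * ((K * S) \ S).card := by exact_mod_cast hB
    have hAB' : (A.card : ℝ) + B.card = S.card := by exact_mod_cast hAB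
    have : (F.card : ℝ) * ((K * S) \ S).card ≤ F.card * (1 / (2 * F.card) * S.card) := by gcongr
    have e : (F.card : ℝ) * (1 / (2 * F.card) * S.card) = S.card / 2 := by field_simp
    linarith

open Classical in
lemma rest_inv {G : Type*} [Group G] (K F S C : Finset G) (δ' : ℝ)
    (hF : IsFolnerInv K⁻¹ δ' F) :
    (((K * (S \ C.biUnion fun c => F.image (· * c))) \ (S \ C.biUnion fun c => F.image (· * c))).card : ℝ)
      ≤ ((K * S) \ S).card + K.card * (C.card * (δ' * F.card)) := by
  rw [inv_iff] at hF
  set U := C.biUnion fun c => F.image (· * c) with hU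
  have hsub : (K * (S \ U)) \ (S \ U) ⊆ ((K * S) \ S) ∪
      K.biUnion fun k => C.biUnion fun c => ((K⁻¹ * F) \ F).image fun t => k * (t * c) := by
    intro x hx
    rw [Finset.mem_sdiff, Finset.mem_mul] at hx
    obtain ⟨⟨k, hk, s, hs, rfl⟩, hx⟩ := hx
    rw [Finset.mem_sdiff] at hs hx
    by_cases h : k * s ∈ S
    · have h2 : k * s ∈ U := by by_contra h2; exact hx ⟨h, h2⟩
      rw [hU, Finset.mem_biUnion] at h2
      obtain ⟨c, hc, h2⟩ := h2
      rw [Finset.mem_image] at h2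
      obtain ⟨f, hf, h2⟩ := h2
      apply Finset.mem_union_right
      simp only [Finset.mem_biUnion, Finset.mem_image, Finset.mem_sdiff]
      have hs' : s = k⁻¹ * f * c := by rw [mul_assoc, h2]; group
      refine ⟨k, hk, c, hc, k⁻¹ * f, ⟨Finset.mul_mem_mul (Finset.inv_mem_inv hk) hf, ?_⟩, ?_⟩
      · intro h3
        apply hs.2
        rw [hU, Finset.mem_biUnion]
        exact ⟨c, hc, Finset.mem_image.2 ⟨_, h3, hs'.symm⟩⟩
      · rw [← hs']
    · apply Finset.mem_union_left
      rw [Finset.mem_sdiff]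
      exact ⟨Finset.mul_mem_mul hk hs.1, h⟩
  have h1 := (Finset.card_le_card hsub).trans (Finset.card_union_le _ _)
  have h2 : (K.biUnion fun k => C.biUnion fun c => ((K⁻¹ * F) \ F).image fun t => k * (t * c)).card
      ≤ K.card * (C.card * ((K⁻¹ * F) \ F).card) :=
    Finset.card_biUnion_le_card_mul _ _ _ fun k _ =>
      Finset.card_biUnion_le_card_mul _ _ _ fun c _ => Finset.card_image_le
  have h3 := h1.trans (Nat.add_le_add_left h2 _)
  have h4 : (((K * (S \ U)) \ (S \ U)).card : ℝ) ≤ ((K * S) \ S).card + K.card * (C.card * ((K⁻¹ * F) \ F).card) := by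
    exact_mod_cast h3
  refine h4.trans ?_
  gcongr

open Classical in
lemma ow_step {G : Type*} [Group G] (φ : Finset G → ℝ) (h0 : φ ∅ = 0)
    (hsub : ∀ A B, φ (A ∪ B) ≤ φ A + φ B) (hinv : ∀ A g, φ (A.image (· * g)) ≤ φ A)
    (C a e c : ℝ) (hC0 : 0 ≤ C) (hC : ∀ A, φ A ≤ C * A.card) (ha : 0 ≤ a) (he : 0 < e) (he1 : e < 1)
    (hc : a / (1 - e) ≤ c)
    (hFol : ∀ (K : Finset G) (δ : ℝ), 0 < δ → ∃ F : Finset G, F.Nonempty ∧ IsFolnerInv K δ F ∧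
      φ F ≤ a * F.card)
    (hT : ∃ (K : Finset G) (δ : ℝ), 0 < δ ∧ ∀ S, IsFolnerInv K δ S → φ S ≤ c * S.card) :
    ∃ (K : Finset G) (δ : ℝ), 0 < δ ∧ ∀ S, IsFolnerInv K δ S →
      φ S ≤ (a / (1 - e) + max (C * e) ((c - a / (1 - e)) * (1 - e / 2))) * S.card := by
  obtain ⟨K, δ, hδ, hT⟩ := hT
  have he' : 0 < 1 - e := by linarith
  set δ' := δ * e * (1 - e) / (2 * (K.card + 1)) with hδ'
  have hδ'0 : 0 < δ' := by positivity
  obtain ⟨F, hFne, hFinv, hFa⟩ := hFol K⁻¹ δ' hδ'0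
  have hFpos : (0 : ℝ) < F.card := by exact_mod_cast hFne.card_pos
  obtain ⟨f₀, hf₀⟩ := hFne
  set b := a / (1 - e) with hb
  have hb0 : 0 ≤ b := by positivity
  refine ⟨K ∪ F.image (· * f₀⁻¹), min (δ * e / 2) (1 / (2 * F.card)), by positivity, fun S hS => ?_⟩
  have hS1 : IsFolnerInv K (δ * e / 2) S :=
    inv_mono Finset.subset_union_left (min_le_left _ _) hS
  have hS2 : IsFolnerInv (F.image (· * f₀⁻¹)) (1 / (2 * F.card)) S :=
    inv_mono Finset.subset_union_right (min_le_right _ _) hS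
  obtain ⟨D, hD, hDc⟩ := centers_big F S f₀ hS2 ⟨f₀, hf₀⟩
  obtain ⟨Cc, hCD, hC1, hC2⟩ := max_family F D e he he1 ⟨f₀, hf₀⟩
  have hbig := cover_big F D _ e ⟨f₀, hf₀⟩ hC2
  have hrest := rest_inv K F S Cc δ' hFinv
  have hφU : φ (Cc.biUnion fun c => F.image (· * c)) ≤ Cc.card * (a * F.card) := by
    clear hCD hC1 hC2 hbig hrest
    induction Cc using Finset.induction_on with
    | empty => simp [h0]
    | insert x s hx ih =>
      rw [Finset.biUnion_insert, Finset.card_insert_of_notMem hx]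
      refine (hsub _ _).trans ?_
      have := hinv F x
      push_cast
      linarith
  have hUS : (Cc.biUnion fun c => F.image (· * c)) ⊆ S :=
    Finset.biUnion_subset.2 fun c hc => hD c (hCD hc)
  set U := Cc.biUnion fun c => F.image (· * c) with hU
  have hφS : φ S ≤ φ U + φ (S \ U) := by
    have := hsub U (S \ U)
    rwa [Finset.union_sdiff_of_subset hUS] at this
  have hcard : ((S \ U).card : ℝ) = S.card - U.card := by
    rw [Finset.card_sdiff_of_subset hUS, Nat.cast_sub (Finset.card_le_card hUS)]
  have hUle : (U.card : ℝ) ≤ S.card := by exact_mod_cast Finset.card_le_card hUS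
  have hCF : (Cc.card : ℝ) * F.card ≤ U.card / (1 - e) := by
    rw [le_div_iff₀ he']; linarith
  have hφU' : φ U ≤ b * U.card := by
    refine hφU.trans ?_
    have : a * ((Cc.card : ℝ) * F.card) ≤ a * (U.card / (1 - e)) := by gcongr
    calc _ = a * ((Cc.card : ℝ) * F.card) := by ring
      _ ≤ _ := this
      _ = _ := by rw [hb]; ring
  have hSn : (0 : ℝ) ≤ S.card := by positivity
  by_cases hsm : ((S \ U).card : ℝ) < e * S.card
  · have h1 : φ (S \ U) ≤ C * (e * S.card) := (hC _).trans (by gcongr)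
    have h2 : b * (U.card : ℝ) ≤ b * S.card := by gcongr
    have h3 : C * e * S.card ≤ max (C * e) ((c - b) * (1 - e / 2)) * S.card := by
      gcongr; exact le_max_left _ _
    nlinarith
  · push Not at hsm
    have h1 : φ (S \ U) ≤ c * (S \ U).card := by
      apply hT
      rw [inv_iff]
      refine hrest.trans ?_
      rw [inv_iff] at hS1
      have h2 : (K.card : ℝ) * (Cc.card * (δ' * F.card)) ≤ δ * e / 2 * S.card := by
        calc (K.card : ℝ) * (Cc.card * (δ' * F.card)) = K.card * δ' * (Cc.card * F.card) := by ring
          _ ≤ K.card * δ' * (U.card / (1 - e)) := by gcongr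
          _ ≤ (K.card + 1) * δ' * (S.card / (1 - e)) := by gcongr; linarith
          _ = _ := by rw [hδ']; field_simp
      nlinarith
    have h4 : (c - b) * (S.card - U.card) ≤ (c - b) * ((1 - e / 2) * S.card) := by
      apply mul_le_mul_of_nonneg_left _ (by linarith)
      nlinarith
    have h3 : (c - b) * (1 - e / 2) * S.card ≤ max (C * e) ((c - b) * (1 - e / 2)) * S.card := by
      gcongr; exact le_max_right _ _
    rw [hcard] at h1
    linarith

theorem ow {G : Type*} [Group G] [DecidableEq G] (φ : Finset G → ℝ) (h0 : φ ∅ = 0)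
    (hsub : ∀ A B, φ (A ∪ B) ≤ φ A + φ B) (hinv : ∀ A g, φ (A.image (· * g)) ≤ φ A)
    (C a b : ℝ) (hC0 : 0 ≤ C) (hC : ∀ A, φ A ≤ C * A.card) (ha : 0 ≤ a) (hab : a < b)
    (hFol : ∀ (K : Finset G) (δ : ℝ), 0 < δ → ∃ F : Finset G, F.Nonempty ∧ IsFolnerInv K δ F ∧
      φ F ≤ a * F.card) :
    ∃ (K : Finset G) (δ : ℝ), 0 < δ ∧ ∀ S, IsFolnerInv K δ S → φ S ≤ b * S.card := by
  obtain ⟨e, he, he1, heb⟩ : ∃ e : ℝ, 0 < e ∧ e < 1 ∧ a / (1 - e) + C * e < b := by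
    refine ⟨min (1 / 2) ((b - a) / (2 * (2 * a + C + 1))), ?_, ?_, ?_⟩
    · have : 0 < b - a := by linarith
      positivity
    · exact (min_le_left _ _).trans_lt (by norm_num)
    · have hp : 0 < b - a := by linarith
      have h0 : 0 < min (1 / 2) ((b - a) / (2 * (2 * a + C + 1))) := by positivity
      have h1 := min_le_left (1 / 2) ((b - a) / (2 * (2 * a + C + 1)))
      have h2 := min_le_right (1 / 2) ((b - a) / (2 * (2 * a + C + 1)))
      set e := min (1 / 2) ((b - a) / (2 * (2 * a + C + 1)))
      rw [le_div_iff₀ (by positivity)] at h2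
      have h3 : a / (1 - e) ≤ a * (1 + 2 * e) := by
        rw [div_le_iff₀ (by linarith)]
        nlinarith [mul_nonneg ha h0.le]
      nlinarith
  have he' : 0 < 1 - e := by linarith
  have hb0 : 0 ≤ a / (1 - e) := by positivity
  have key : ∀ k : ℕ, ∃ (K : Finset G) (δ : ℝ), 0 < δ ∧ ∀ S, IsFolnerInv K δ S →
      φ S ≤ (a / (1 - e) + max (C * e) (C * (1 - e / 2) ^ k)) * S.card := by
    intro k
    induction k with
    | zero =>
      refine ⟨∅, 1, one_pos, fun S _ => (hC S).trans ?_⟩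
      gcongr
      have := le_max_right (C * e) (C * (1 - e / 2) ^ 0)
      simp only [pow_zero, mul_one] at this ⊢
      linarith
    | succ k ih =>
      have hstep := ow_step φ h0 (fun A B => by convert hsub A B) (fun A g => by convert hinv A g) C a e _ hC0 hC ha he he1
        (by have : 0 ≤ max (C * e) (C * (1 - e / 2) ^ k) := le_max_of_le_left (by positivity)
            linarith) hFol ih
      obtain ⟨K, δ, hδ, h⟩ := hstep
      refine ⟨K, δ, hδ, fun S hS => (h S hS).trans ?_⟩
      apply mul_le_mul_of_nonneg_right _ (Nat.cast_nonneg _)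
      apply add_le_add_right
      apply max_le (le_max_left _ _)
      rw [add_sub_cancel_left, max_mul_of_nonneg _ _ (by linarith)]
      apply max_le_max
      · have : 0 ≤ C * e := by positivity
        nlinarith
      · rw [pow_succ]; linarith
  obtain ⟨k, hk⟩ : ∃ k : ℕ, C * (1 - e / 2) ^ k < b - a / (1 - e) := by
    have : Filter.Tendsto (fun k : ℕ => C * (1 - e / 2) ^ k) Filter.atTop (nhds (C * 0)) :=
      (tendsto_pow_atTop_nhds_zero_of_lt_one (by linarith) (by linarith)).const_mul C
    rw [mul_zero] at this
    have hpos : 0 < b - a / (1 - e) := by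
      have : 0 ≤ C * e := by positivity
      linarith
    exact (this.eventually (gt_mem_nhds hpos)).exists
  obtain ⟨K, δ, hδ, h⟩ := key k
  refine ⟨K, δ, hδ, fun S hS => (h S hS).trans ?_⟩
  gcongr
  have : max (C * e) (C * (1 - e / 2) ^ k) ≤ b - a / (1 - e) := max_le (by linarith) hk.le
  linarith

end OW
section PUsec
def PU {X : Type*} [TopologicalSpace X] (R : X → X → Prop) (n : ℕ) : Prop :=
  ∃ (N : ℕ) (p : ℕ → X → ℝ), (∀ i < N, Continuous (p i)) ∧ (∀ i x, 0 ≤ p i x) ∧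
    (∀ x, ∑ i ∈ Finset.range N, p i x = 1) ∧
    (∀ x, ((Finset.range N).filter fun i => p i x ≠ 0).card ≤ n + 1) ∧
    ∀ i < N, ∀ x y, p i x ≠ 0 → p i y ≠ 0 → R x y

lemma PU_of {X : Type*} [TopologicalSpace X] {R : X → X → Prop} {n : ℕ} {κ : Type*} [Fintype κ]
    (q : κ → X → ℝ) (hq : ∀ i, Continuous (q i)) (h0 : ∀ i x, 0 ≤ q i x)
    (h1 : ∀ x, ∑ i, q i x = 1) (hc : ∀ x, (Finset.univ.filter fun i => q i x ≠ 0).card ≤ n + 1)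
    (hR : ∀ i x y, q i x ≠ 0 → q i y ≠ 0 → R x y) : PU R n := by
  classical
  let e := Fintype.equivFin κ
  refine ⟨Fintype.card κ, fun i x => if h : i < Fintype.card κ then q (e.symm ⟨i, h⟩) x else 0,
    ?_, ?_, ?_, ?_, ?_⟩
  · intro i hi
    simp only [hi, dite_true]
    exact hq _
  · intro i x
    dsimp only
    split_ifs
    · exact h0 _ _
    · exact le_rfl
  · intro x
    rw [Finset.sum_range]
    simp only [Fin.is_lt, dite_true, Fin.eta]
    rw [Equiv.sum_comp e.symm (fun i => q i x), h1]
  · intro x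
    refine le_trans ?_ (hc x)
    apply Finset.card_le_card_of_surjOn (fun k => (e k : ℕ))
    intro i hi
    simp only [Finset.coe_filter, Finset.mem_range, Set.mem_ofPred_eq] at hi
    obtain ⟨hi, hne⟩ := hi
    rw [dif_pos hi] at hne
    exact ⟨e.symm ⟨i, hi⟩, by simpa using hne, by simp⟩
  · intro i hi x y
    simp only [hi, dite_true]
    exact hR _ _ _

lemma PU.mono {X : Type*} [TopologicalSpace X] {R R' : X → X → Prop} {n : ℕ} (h : PU R n)
    (hR : ∀ x y, R x y → R' x y) : PU R' n := by
  obtain ⟨N, p, h1, h2, h3, h4, h5⟩ := h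
  exact ⟨N, p, h1, h2, h3, h4, fun i hi x y hx hy => hR _ _ (h5 i hi x y hx hy)⟩

lemma PU.comp {X : Type*} [TopologicalSpace X] {R : X → X → Prop} {n : ℕ} (h : PU R n)
    (f : X → X) (hf : Continuous f) : PU (fun x y => R (f x) (f y)) n := by
  obtain ⟨N, p, h1, h2, h3, h4, h5⟩ := h
  exact ⟨N, fun i x => p i (f x), fun i hi => (h1 i hi).comp hf, fun i x => h2 i _, fun x => h3 _,
    fun x => h4 _, fun i hi x y hx hy => h5 i hi _ _ hx hy⟩

lemma PU_true {X : Type*} [TopologicalSpace X] {R : X → X → Prop} (hR : ∀ x y, R x y) : PU R 0 :=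
  ⟨1, fun _ _ => 1, fun _ _ => continuous_const, fun _ _ => zero_le_one, fun _ => by simp,
    fun _ => (Finset.card_filter_le _ _).trans (by simp), fun _ _ x y _ _ => hR x y⟩

lemma chain_card (A B : Finset ℕ) (Z : Finset (ℕ × ℕ)) (a b : ℕ) (hA : A.card ≤ a + 1)
    (hB : B.card ≤ b + 1) (hZA : ∀ z ∈ Z, z.1 ∈ A) (hZB : ∀ z ∈ Z, z.2 ∈ B)
    (hch : ∀ z ∈ Z, ∀ z' ∈ Z, z.1 < z'.1 → z.2 ≤ z'.2) : Z.card ≤ a + b + 1 := by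
  let g : ℕ × ℕ → ℕ := fun z => (A.filter (· < z.1)).card + (B.filter (· < z.2)).card
  have hle : ∀ (A : Finset ℕ) (i j : ℕ), i ≤ j → (A.filter (· < i)).card ≤ (A.filter (· < j)).card := by
    intro A i j hij
    apply Finset.card_le_card
    intro k hk
    simp only [Finset.mem_filter] at hk ⊢
    exact ⟨hk.1, hk.2.trans_le hij⟩
  have hlt : ∀ (A : Finset ℕ) (i j : ℕ), i ∈ A → i < j → (A.filter (· < i)).card < (A.filter (· < j)).card := by
    intro A i j hi hij
    apply Finset.card_lt_card
    rw [Finset.ssubset_iff_of_subset]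
    · exact ⟨i, by simp [hi, hij], by simp⟩
    · intro k hk
      simp only [Finset.mem_filter] at hk ⊢
      exact ⟨hk.1, hk.2.trans hij⟩
  have hlt1 : ∀ (A : Finset ℕ) (i : ℕ), i ∈ A → (A.filter (· < i)).card < A.card := by
    intro A i hi
    apply Finset.card_lt_card
    rw [Finset.ssubset_iff_of_subset (Finset.filter_subset _ _)]
    exact ⟨i, hi, by simp⟩
  have hmaps : ∀ z ∈ Z, g z ∈ Finset.range (a + b + 1) := by
    intro z hz
    have h1 := hlt1 A _ (hZA z hz)
    have h2 := hlt1 B _ (hZB z hz)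
    simp only [g, Finset.mem_range]
    omega
  have key : ∀ z ∈ Z, ∀ z' ∈ Z, z.1 < z'.1 → g z < g z' := by
    intro z hz z' hz' h
    exact add_lt_add_of_lt_of_le (hlt A _ _ (hZA z hz) h) (hle B _ _ (hch z hz z' hz' h))
  have hinj : Set.InjOn g Z := by
    intro z hz z' hz' hg
    rcases lt_trichotomy z.1 z'.1 with h | h | h
    · exact absurd hg (key z hz z' hz' h).ne
    · rcases lt_trichotomy z.2 z'.2 with h' | h' | h'
      · have := hlt B _ _ (hZB z hz) h'
        simp only [g, h] at hg
        omega
      · exact Prod.ext h h'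
      · have := hlt B _ _ (hZB z' hz') h'
        simp only [g, h] at hg
        omega
    · exact absurd hg (key z' hz' z hz h).ne'
  simpa using Finset.card_le_card_of_injOn g hmaps hinj

lemma PU.inter {X : Type*} [TopologicalSpace X] {R R' : X → X → Prop} {n n' : ℕ} (h : PU R n)
    (h' : PU R' n') : PU (fun x y => R x y ∧ R' x y) (n + n') := by
  classical
  obtain ⟨N, p, h1, h2, h3, h4, h5⟩ := h
  obtain ⟨M, q, k1, k2, k3, k4, k5⟩ := h'
  let P : ℕ → X → ℝ := fun i x => ∑ j ∈ Finset.range i, p j x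
  let Q : ℕ → X → ℝ := fun i x => ∑ j ∈ Finset.range i, q j x
  have hPs : ∀ i x, P (i + 1) x = P i x + p i x := fun i x => Finset.sum_range_succ _ _
  have hQs : ∀ i x, Q (i + 1) x = Q i x + q i x := fun i x => Finset.sum_range_succ _ _
  have hPm : ∀ x, Monotone fun i => P i x := fun x =>
    monotone_nat_of_le_succ fun i => by rw [hPs]; linarith [h2 i x]
  have hQm : ∀ x, Monotone fun i => Q i x := fun x =>
    monotone_nat_of_le_succ fun i => by rw [hQs]; linarith [k2 i x]
  have hPc : ∀ i ≤ N, Continuous (P i) := fun i hi =>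
    continuous_finsetSum _ fun j hj => h1 j ((Finset.mem_range.1 hj).trans_le hi)
  have hQc : ∀ i ≤ M, Continuous (Q i) := fun i hi =>
    continuous_finsetSum _ fun j hj => k1 j ((Finset.mem_range.1 hj).trans_le hi)
  let H : ℕ → X → ℝ → ℝ := fun i x t => max (P i x) (min (P (i + 1) x) t)
  have hHm : ∀ i x, Monotone (H i x) := fun i x s t hst =>
    max_le_max le_rfl (min_le_min le_rfl hst)
  let r : ℕ → ℕ → X → ℝ := fun i j x => H i x (Q (j + 1) x) - H i x (Q j x)
  have hr : ∀ i j x, r i j x ≠ 0 → P i x < Q (j + 1) x ∧ Q j x < P (i + 1) x ∧ p i x ≠ 0 ∧ q j x ≠ 0 := by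
    intro i j x hne
    have hp := hPs i x
    have hq := hQs j x
    have := h2 i x
    have := k2 j x
    refine ⟨?_, ?_, ?_, ?_⟩
    · by_contra hcon
      push Not at hcon
      apply hne
      simp only [r, H]
      rw [max_eq_left, max_eq_left, sub_self]
      · exact (min_le_right _ _).trans (by linarith)
      · exact (min_le_right _ _).trans hcon
    · by_contra hcon
      push Not at hcon
      apply hne
      simp only [r, H]
      rw [min_eq_left hcon, min_eq_left (by linarith), sub_self]
    · intro h0
      apply hne
      simp only [r, H, hp, h0, add_zero]
      rw [max_eq_left (min_le_left _ _), max_eq_left (min_le_left _ _), sub_self]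
    · intro h0
      apply hne
      simp only [r, hq, h0, add_zero, sub_self]
  refine PU_of (κ := Fin N × Fin M) (fun z x => r z.1 z.2 x) ?_ ?_ ?_ ?_ ?_
  · rintro ⟨i, j⟩
    have c1 := hPc i i.2.le
    have c2 := hPc (i + 1) i.2
    have c3 := hQc j j.2.le
    have c4 := hQc (j + 1) j.2
    simp only [r, H]
    exact (c1.max (c2.min c4)).sub (c1.max (c2.min c3))
  · rintro ⟨i, j⟩ x
    have := hHm i x (hQm x (Nat.le_succ j))
    simp only [r]
    exact sub_nonneg.2 this
  · intro x
    rw [Fintype.sum_prod_type]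
    have hin : ∀ i < N, ∑ j : Fin M, r i j x = p i x := by
      intro i hi
      rw [← Finset.sum_range (fun j => r i j x)]
      simp only [r]
      rw [Finset.sum_range_sub (fun j => H i x (Q j x))]
      have e1 : Q M x = 1 := k3 x
      have e2 : Q 0 x = 0 := by simp [Q]
      have e3 : P N x = 1 := h3 x
      have e4 : P 0 x = 0 := by simp [P]
      have e5 := hPm x (Nat.zero_le i)
      have e6 := hPm x (Nat.succ_le_of_lt hi)
      have e7 := hPm x (Nat.le_succ i)
      have e8 := hPs i x
      simp only [Nat.succ_eq_add_one] at e5 e6 e7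
      simp only [H]
      rw [e1, e2, min_eq_left (by linarith), max_eq_right e7, min_eq_right (by linarith),
        max_eq_left (by linarith)]
      linarith
    rw [Finset.sum_congr rfl fun (i : Fin N) _ => hin i i.2, ← Finset.sum_range (fun i => p i x), h3]
  · intro x
    have := chain_card _ _ ((Finset.univ.filter fun z : Fin N × Fin M => r z.1 z.2 x ≠ 0).image
      fun z => ((z.1 : ℕ), (z.2 : ℕ))) n n' (h4 x) (k4 x) ?_ ?_ ?_
    · rwa [Finset.card_image_of_injective] at this
      rintro ⟨i, j⟩ ⟨i', j'⟩ h
      simp only [Prod.mk.injEq] at h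
      exact Prod.ext (Fin.ext h.1) (Fin.ext h.2)
    · intro z hz
      simp only [Finset.mem_image, Finset.mem_filter, Finset.mem_univ, true_and] at hz
      obtain ⟨w, hw, rfl⟩ := hz
      simpa using (hr _ _ _ hw).2.2.1
    · intro z hz
      simp only [Finset.mem_image, Finset.mem_filter, Finset.mem_univ, true_and] at hz
      obtain ⟨w, hw, rfl⟩ := hz
      simpa using (hr _ _ _ hw).2.2.2
    · intro z hz z' hz' hlt
      simp only [Finset.mem_image, Finset.mem_filter, Finset.mem_univ, true_and] at hz hz'
      obtain ⟨w, hw, rfl⟩ := hz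
      obtain ⟨w', hw', rfl⟩ := hz'
      simp only at hlt ⊢
      by_contra hcon
      push Not at hcon
      have e1 := (hr _ _ _ hw).2.1
      have e2 := (hr _ _ _ hw').1
      have e3 := hPm x (Nat.succ_le_of_lt hlt)
      have e4 := hQm x (Nat.succ_le_of_lt hcon)
      simp only [Nat.succ_eq_add_one] at e3 e4
      linarith
  · rintro ⟨i, j⟩ x y hx hy
    have a1 := hr _ _ _ hx
    have a2 := hr _ _ _ hy
    exact ⟨h5 i i.2 x y a1.2.2.1 a2.2.2.1, k5 j j.2 x y a1.2.2.2 a2.2.2.2⟩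

lemma PU_of_cover {X : Type*} [MetricSpace X] [CompactSpace X] {R : X → X → Prop} {n : ℕ}
    (𝒰 : Finset (Set X)) (ho : ∀ U ∈ 𝒰, IsOpen U) (hc : ∀ x : X, ∃ U ∈ 𝒰, x ∈ U)
    (hR : ∀ U ∈ 𝒰, ∀ x ∈ U, ∀ y ∈ U, R x y)
    (hn : ∀ x : X, {U : Set X | U ∈ 𝒰 ∧ x ∈ U}.ncard ≤ n + 1) : PU R n := by
  classical
  obtain ⟨f, hf⟩ := PartitionOfUnity.exists_isSubordinate (X := X) isClosed_univ
    (fun U : 𝒰 => (U : Set X)) (fun U => ho U U.2) (fun x _ => by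
      obtain ⟨U, hU, hx⟩ := hc x
      exact Set.mem_iUnion.2 ⟨⟨U, hU⟩, hx⟩)
  have hmem : ∀ (U : 𝒰) x, f U x ≠ 0 → x ∈ (U : Set X) := fun U x hx =>
    hf U (subset_tsupport _ hx)
  refine PU_of (fun (U : 𝒰) x => f U x) (fun U => (f U).continuous) (fun U x => f.nonneg U x) ?_ ?_ ?_
  · intro x
    rw [← finsum_eq_sum_of_fintype]
    exact f.sum_eq_one (Set.mem_univ x)
  · intro x
    refine le_trans ?_ (hn x)
    have hfin : {U : Set X | U ∈ 𝒰 ∧ x ∈ U}.Finite := (Finset.finite_toSet 𝒰).subset fun U hU => hU.1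
    rw [← Set.ncard_coe_finset]
    refine Set.ncard_le_ncard_of_injOn (fun U : 𝒰 => (U : Set X)) ?_ ?_ hfin
    · intro U hU
      simp only [Finset.coe_filter, Finset.mem_univ, true_and] at hU
      exact ⟨U.2, hmem U x hU⟩
    · exact Subtype.val_injective.injOn
  · intro U x y hx hy
    exact hR U U.2 x (hmem U x hx) y (hmem U y hy)

lemma cover_of_PU {X : Type*} [TopologicalSpace X] {R : X → X → Prop} {n : ℕ} (h : PU R n) :
    ∃ 𝒰 : Finset (Set X),
    (∀ U ∈ 𝒰, IsOpen U) ∧ (∀ x : X, ∃ U ∈ 𝒰, x ∈ U) ∧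
    (∀ U ∈ 𝒰, ∀ x ∈ U, ∀ y ∈ U, R x y) ∧
    ∀ x : X, {U : Set X | U ∈ 𝒰 ∧ x ∈ U}.ncard ≤ n + 1 := by
  classical
  obtain ⟨N, p, h1, h2, h3, h4, h5⟩ := h
  refine ⟨(Finset.range N).image fun i => Function.support (p i), ?_, ?_, ?_, ?_⟩
  · intro U hU
    obtain ⟨i, hi, rfl⟩ := Finset.mem_image.1 hU
    exact (h1 i (Finset.mem_range.1 hi)).isOpen_support
  · intro x
    obtain ⟨i, hi, hne⟩ := Finset.exists_ne_zero_of_sum_ne_zero (by rw [h3 x]; exact one_ne_zero)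
    exact ⟨_, Finset.mem_image_of_mem _ hi, hne⟩
  · intro U hU x hx y hy
    obtain ⟨i, hi, rfl⟩ := Finset.mem_image.1 hU
    exact h5 i (Finset.mem_range.1 hi) x y hx hy
  · intro x
    refine le_trans ?_ (h4 x)
    refine le_trans ?_ (Finset.card_image_le (f := fun i => Function.support (p i)))
    rw [← Set.ncard_coe_finset]
    refine Set.ncard_le_ncard ?_ (Finset.finite_toSet _)
    rintro U ⟨hU, hx⟩
    obtain ⟨i, hi, rfl⟩ := Finset.mem_image.1 hU
    exact Finset.mem_coe.2 (Finset.mem_image.2 ⟨i, Finset.mem_filter.2 ⟨hi, hx⟩, rfl⟩)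

/-- orbit closeness -/
def ORel {G X : Type*} [Group G] [MetricSpace X] (α : GAction G X) (ε : ℝ) (F : Finset G) (x y : X) :
    Prop := ∀ g ∈ F, dist (α.act g x) (α.act g y) ≤ ε

lemma dyn_le_iff {G X : Type*} [Group G] [MetricSpace X] (α : GAction G X) (ε : ℝ) (hε : 0 < ε)
    (F : Finset G) (x y : X) : dynMetric α dist F x y ≤ ε ↔ ORel α ε F x y := by
  unfold dynMetric ORel
  lift ε to NNReal using hε.le
  rw [NNReal.coe_le_coe, Finset.sup_le_iff]
  simp [Real.toNNReal_le_iff_le_coe]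

lemma widim_eq {G X : Type*} [Group G] [MetricSpace X] [CompactSpace X] (α : GAction G X) (ε : ℝ)
    (hε : 0 < ε) (F : Finset G) :
    widim (dynMetric α dist F) ε = sInf {n | PU (ORel α ε F) n} := by
  unfold widim
  congr 1
  ext n
  simp only [Set.mem_ofPred_eq, dyn_le_iff α ε hε]
  constructor
  · rintro ⟨𝒰, h1, h2, h3, h4⟩
    exact PU_of_cover 𝒰 h1 h2 h3 h4
  · exact cover_of_PU

lemma PU_dist {X : Type*} [MetricSpace X] [CompactSpace X] (ε : ℝ) (hε : 0 < ε) :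
    ∃ n, PU (fun x y : X => dist x y ≤ ε) n := by
  classical
  obtain ⟨t, ht⟩ := CompactSpace.elim_nhds_subcover (fun x : X => Metric.ball x (ε / 2))
    (fun x => Metric.ball_mem_nhds x (by positivity))
  refine ⟨t.card, PU_of_cover (t.image fun x => Metric.ball x (ε / 2)) ?_ ?_ ?_ ?_⟩
  · intro U hU
    obtain ⟨x, _, rfl⟩ := Finset.mem_image.1 hU
    exact Metric.isOpen_ball
  · intro x
    have : x ∈ ⋃ x ∈ t, Metric.ball x (ε / 2) := by rw [ht]; trivial
    simp only [Set.mem_iUnion] at this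
    obtain ⟨y, hy, hx⟩ := this
    exact ⟨_, Finset.mem_image_of_mem _ hy, hx⟩
  · intro U hU x hx y hy
    obtain ⟨z, _, rfl⟩ := Finset.mem_image.1 hU
    have := dist_triangle_right x y z
    rw [Metric.mem_ball] at hx hy
    linarith
  · intro x
    have h1 : {U : Set X | U ∈ t.image (fun x => Metric.ball x (ε / 2)) ∧ x ∈ U}.ncard ≤
        (t.image (fun x => Metric.ball x (ε / 2))).card := by
      rw [← Set.ncard_coe_finset]
      exact Set.ncard_le_ncard (fun U hU => hU.1) (Finset.finite_toSet _)
    have h2 : (t.image (fun x => Metric.ball x (ε / 2))).card ≤ t.card := Finset.card_image_le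
    omega

open Classical in
lemma ORel_union {G X : Type*} [Group G] [MetricSpace X] (α : GAction G X) (ε : ℝ) (A B : Finset G)
    {x y : X} (h : ORel α ε A x y ∧ ORel α ε B x y) : ORel α ε (A ∪ B) x y := by
  intro g hg
  rcases Finset.mem_union.1 hg with hg | hg
  · exact h.1 g hg
  · exact h.2 g hg

lemma PU_all {G X : Type*} [Group G] [MetricSpace X] [CompactSpace X] (α : GAction G X)
    (hα : ∀ g, Continuous (α.act g)) (ε : ℝ) (hε : 0 < ε) :
    ∃ C : ℕ, ∀ F : Finset G, PU (ORel α ε F) (C * F.card) := by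
  classical
  obtain ⟨C, hC⟩ := PU_dist (X := X) ε hε
  refine ⟨C, fun F => ?_⟩
  induction F using Finset.induction_on with
  | empty => simpa using PU_true (R := ORel α ε ∅) (fun x y g hg => by simp at hg)
  | insert a s ha ih =>
    rw [Finset.card_insert_of_notMem ha, mul_add, mul_one]
    refine (ih.inter (hC.comp _ (hα a))).mono ?_
    intro x y h g hg
    rcases Finset.mem_insert.1 hg with rfl | hg
    · exact h.2
    · exact h.1 g hg

theorem good_inv {G X : Type*} [Group G] [MetricSpace X] [CompactSpace X] (m : ℕ)
    (Fseq : ℕ → Finset G) (hFseq : IsFolnerSeq Fseq)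
    (α : GAction G X) (hα : ∀ g, Continuous (α.act g))
    (hmdim : mdim α dist Fseq < (m : ℝ≥0∞) / 2) (ε : ℝ) (hε : 0 < ε) :
    ∃ (K : Finset G) (δ : ℝ), 0 < δ ∧ ∀ S : Finset G, S.Nonempty → IsFolnerInv K δ S →
      ∃ n, PU (ORel α ε S) n ∧ 2 * n < m * S.card := by
  classical
  have hlt : mdimEps α dist Fseq ε < (m : ℝ≥0∞) / 2 :=
    lt_of_le_of_lt (le_iSup₂_of_le ε hε le_rfl) hmdim
  obtain ⟨a, ha1, ha2⟩ := ENNReal.lt_iff_exists_nnreal_btwn.1 hlt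
  have ham : (a : ℝ) < m / 2 := by
    have h : (a : ℝ≥0∞) < ((m / 2 : NNReal) : ℝ≥0∞) := by
      rw [ENNReal.coe_div (by norm_num)]; simpa using ha2
    have := ENNReal.coe_lt_coe.1 h
    have := NNReal.coe_lt_coe.2 this
    simpa using this
  have hev := Filter.eventually_lt_of_limsup_lt ha1
  obtain ⟨N0, hN0⟩ := Filter.eventually_atTop.1 hev
  obtain ⟨C, hC⟩ := PU_all α hα ε hε
  let φ : Finset G → ℕ := fun F => sInf {n | PU (ORel α ε F) n}
  have hφmem : ∀ F, PU (ORel α ε F) (φ F) := fun F =>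
    Nat.sInf_mem (s := {n | PU (ORel α ε F) n}) ⟨_, hC F⟩
  have hφle : ∀ F n, PU (ORel α ε F) n → φ F ≤ n := fun F n h => Nat.sInf_le h
  obtain ⟨b, hab, hbm⟩ := exists_between ham
  obtain ⟨K, δ, hδ, h⟩ := ow (fun F => (φ F : ℝ))
    (by have := hφle ∅ 0 (PU_true (fun x y g hg => by simp at hg)); simpa using this)
    (fun A B => by
      have := hφle (A ∪ B) _ (((hφmem A).inter (hφmem B)).mono fun x y h => by
        convert ORel_union α ε A B h)
      exact_mod_cast this)
    (fun A g => by
      have := hφle (A.image (· * g)) _ (((hφmem A).comp _ (hα g)).mono fun x y h => by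
        intro k hk
        obtain ⟨a, ha, rfl⟩ := Finset.mem_image.1 hk
        rw [α.act_mul, α.act_mul]
        exact h a ha)
      exact_mod_cast this)
    C a b (by positivity) (fun A => by exact_mod_cast hφle A _ (hC A)) a.2 hab
    (fun K δ hδ => by
      obtain ⟨N1, hN1⟩ := hFseq.2 K δ hδ
      refine ⟨Fseq (max N0 N1), hFseq.1 _, hN1 _ (le_max_right _ _), ?_⟩
      have h1 := hN0 (max N0 N1) (le_max_left _ _)
      have hne := hFseq.1 (max N0 N1)
      rw [widim_eq α ε hε] at h1
      have h2 := (ENNReal.div_le_iff (by simpa using hne.ne_empty) (by simp)).1 h1.le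
      have h3 : ((φ (Fseq (max N0 N1)) : NNReal)) ≤ a * (Fseq (max N0 N1)).card := by
        rw [← ENNReal.coe_le_coe]
        push_cast
        exact h2
      exact_mod_cast h3)
  refine ⟨K, δ, hδ, fun S hne hS => ⟨φ S, hφmem S, ?_⟩⟩
  have h1 : (φ S : ℝ) ≤ b * S.card := h S hS
  have h2 : (0 : ℝ) < S.card := by exact_mod_cast hne.card_pos
  have h3 : (2 * φ S : ℝ) < m * S.card := by nlinarith
  exact_mod_cast h3
end PUsec
section GP
open MeasureTheory in
lemma avoid {ι J : Type*} [Fintype ι] [Fintype J] (O : Set (ι → ℝ)) (hO : IsOpen O)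
    (hne : O.Nonempty) (w : J → ι → ℝ) :
    ∃ u ∈ O, ∀ t : Finset J, t.card ≤ Fintype.card ι → u ∉ affineSpan ℝ (w '' (t : Set J)) := by
  classical
  have hnull : volume (⋃ t ∈ {t : Finset J | t.card ≤ Fintype.card ι},
      (affineSpan ℝ (w '' (t : Set J)) : Set (ι → ℝ))) = 0 := by
    rw [measure_biUnion_null_iff (Set.to_countable _)]
    intro t ht
    apply Measure.addHaar_affineSubspace
    intro htop
    have htne : t.Nonempty := by
      rw [Finset.nonempty_iff_ne_empty]
      rintro rfl
      simp at htop
    have h2 : vectorSpan ℝ (w '' (t : Set J)) = ⊤ := by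
      rw [← direction_affineSpan, htop, AffineSubspace.direction_top]
    obtain ⟨n, hn⟩ := Nat.exists_eq_succ_of_ne_zero htne.card_pos.ne'
    have h3 := finrank_vectorSpan_image_finset_le ℝ w t hn
    rw [Finset.coe_image, h2, finrank_top, Module.finrank_fintype_fun_eq_card] at h3
    simp only [Set.mem_ofPred_eq] at ht
    omega
  have hpos := hO.measure_pos volume hne
  by_contra hcon
  push Not at hcon
  have hsub : O ⊆ ⋃ t ∈ {t : Finset J | t.card ≤ Fintype.card ι},
      (affineSpan ℝ (w '' (t : Set J)) : Set (ι → ℝ)) := by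
    intro u hu
    obtain ⟨t, ht, hut⟩ := hcon u hu
    simp only [Set.mem_iUnion]
    exact ⟨t, ht, hut⟩
  exact hpos.ne' (measure_mono_null hsub hnull)

lemma gp {ι J : Type*} [Fintype ι] [Fintype J] [DecidableEq J] (O : J → Set (ι → ℝ))
    (hO : ∀ j, IsOpen (O j)) (hne : ∀ j, (O j).Nonempty) :
    ∃ w : J → ι → ℝ, (∀ j, w j ∈ O j) ∧ ∀ c : J → ℝ, ∑ j, c j = 0 → ∑ j, c j • w j = 0 →
      (Finset.univ.filter fun j => c j ≠ 0).card ≤ Fintype.card ι + 1 → c = 0 := by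
  have key : ∀ s : Finset J, ∃ w : J → ι → ℝ, (∀ j, w j ∈ O j) ∧ ∀ c : J → ℝ, (∀ j ∉ s, c j = 0) →
      ∑ j, c j = 0 → ∑ j, c j • w j = 0 →
      (Finset.univ.filter fun j => c j ≠ 0).card ≤ Fintype.card ι + 1 → c = 0 := by
    intro s
    induction s using Finset.induction_on with
    | empty =>
      choose w hw using hne
      exact ⟨w, hw, fun c hc _ _ _ => funext fun j => hc j (by simp)⟩
    | insert a s ha ih =>
      obtain ⟨w, hw, hind⟩ := ih
      obtain ⟨u, huO, hu⟩ := avoid (O a) (hO a) (hne a) w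
      refine ⟨Function.update w a u, fun j => ?_, fun c hcs hc0 hcw hcard => ?_⟩
      · by_cases h : j = a
        · subst h; simpa using huO
        · simpa [h] using hw j
      by_cases hca : c a = 0
      · refine hind c (fun j hj => ?_) hc0 ?_ hcard
        · by_cases h : j = a
          · subst h; exact hca
          · exact hcs j (by simp [h, hj])
        · rw [← hcw]
          refine Finset.sum_congr rfl fun j _ => ?_
          by_cases h : j = a
          · subst h; simp [hca]
          · simp [h]
      · exfalso
        set t := (Finset.univ.filter fun j => c j ≠ 0).erase a with ht
        have hat : a ∈ Finset.univ.filter fun j => c j ≠ 0 := by simp [hca]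
        have htc : t.card ≤ Fintype.card ι := by
          rw [ht, Finset.card_erase_of_mem hat]; omega
        apply hu t htc
        have hs0 : c a + ∑ j ∈ t, c j = 0 := by
          rw [ht, Finset.add_sum_erase _ _ hat, Finset.sum_filter_ne_zero, hc0]
        have hs1 : c a • u + ∑ j ∈ t, c j • w j = 0 := by
          have h1 : ∑ j ∈ t, c j • w j = ∑ j ∈ t, c j • Function.update w a u j := by
            refine Finset.sum_congr rfl fun j hj => ?_
            rw [Function.update_of_ne (Finset.ne_of_mem_erase hj)]
          have h2 : c a • u = c a • Function.update w a u a := by simp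
          rw [h1, h2, ht, Finset.add_sum_erase _ (fun j => c j • Function.update w a u j) hat, ← hcw]
          apply Finset.sum_subset (Finset.subset_univ _)
          intro j _ hj
          simp only [Finset.mem_filter, Finset.mem_univ, true_and, not_not] at hj
          simp [hj]
        have hw1 : ∑ j ∈ t, (-(c a)⁻¹ * c j) = 1 := by
          rw [← Finset.mul_sum, eq_neg_of_add_eq_zero_right hs0]
          field_simp
        have hmem := affineCombination_mem_affineSpan_image hw1 (s' := (t : Set J)) (by
          intro j hj hj'; exact absurd hj hj') w
        rw [Finset.affineCombination_eq_linear_combination _ _ _ hw1] at hmem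
        convert hmem
        simp only [mul_smul]
        rw [← Finset.smul_sum, eq_neg_of_add_eq_zero_right hs1]
        simp [smul_smul, hca]
  obtain ⟨w, h1, h2⟩ := key Finset.univ
  exact ⟨w, h1, fun c => h2 c (by simp)⟩

lemma gp_cube {ι J : Type*} [Fintype ι] [Fintype J] [DecidableEq J] (v : J → ι → ℝ)
    (hv : ∀ j i, v j i ∈ Set.Icc (0 : ℝ) 1) (δ : ℝ) (hδ : 0 < δ) :
    ∃ w : J → ι → ℝ, (∀ j i, w j i ∈ Set.Icc (0 : ℝ) 1 ∧ |w j i - v j i| < δ) ∧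
      ∀ c : J → ℝ, ∑ j, c j = 0 → ∑ j, c j • w j = 0 →
      (Finset.univ.filter fun j => c j ≠ 0).card ≤ Fintype.card ι + 1 → c = 0 := by
  obtain ⟨w, hw, h⟩ := gp (fun j => Set.univ.pi fun i : ι => Set.Ioo (0 : ℝ) 1 ∩ {r | |r - v j i| < δ})
    (fun j => isOpen_set_pi Set.finite_univ fun i _ =>
      isOpen_Ioo.inter (isOpen_lt (by fun_prop) continuous_const)) (fun j => by
      rw [Set.univ_pi_nonempty_iff]
      intro i
      obtain ⟨h0, h1⟩ := hv j i
      have ht0 : 0 < min δ 1 := by positivity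
      have ht1 := min_le_left δ 1
      have ht2 := min_le_right δ 1
      set t := min δ 1
      refine ⟨v j i + t * (1 / 2 - v j i), ⟨?_, ?_⟩, ?_⟩
      · nlinarith
      · nlinarith
      · simp only [Set.mem_ofPred_eq]
        rw [abs_lt]
        constructor <;> nlinarith)
  refine ⟨w, fun j i => ?_, h⟩
  have := hw j i (Set.mem_univ _)
  exact ⟨Set.Ioo_subset_Icc_self this.1, this.2⟩
end GP
section Main
lemma embed {X ι : Type*} [TopologicalSpace X] [Fintype ι] {R : X → X → Prop} {n : ℕ}
    (h : PU R n) (hn : 2 * n < Fintype.card ι) (f₀ : X → ι → ℝ)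
    (hf₀ : ∀ x i, f₀ x i ∈ Set.Icc (0 : ℝ) 1) (δ : ℝ) (hδ : 0 < δ)
    (hR : ∀ x y, R x y → ∀ i, |f₀ x i - f₀ y i| ≤ δ / 2) :
    ∃ f : X → ι → ℝ, Continuous f ∧ (∀ x i, f x i ∈ Set.Icc (0 : ℝ) 1) ∧
      (∀ x i, |f x i - f₀ x i| ≤ δ) ∧ ∀ x y, f x = f y → R x y := by
  classical
  obtain ⟨N, p, h1, h2, h3, h4, h5⟩ := h
  have hv : ∀ j : Fin N, ∃ v : ι → ℝ, (∀ i, v i ∈ Set.Icc (0 : ℝ) 1) ∧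
      ∀ x, p j x ≠ 0 → ∀ i, |v i - f₀ x i| ≤ δ / 2 := by
    intro j
    by_cases hj : ∃ y, p j y ≠ 0
    · obtain ⟨y, hy⟩ := hj
      exact ⟨f₀ y, hf₀ y, fun x hx i => hR y x (h5 j j.2 y x hy hx) i⟩
    · push Not at hj
      exact ⟨0, fun i => by simp, fun x hx => absurd (hj x) hx⟩
  choose v hv1 hv2 using hv
  obtain ⟨w, hw, hgp⟩ := gp_cube v hv1 (δ / 2) (by positivity)
  have h3' : ∀ x, ∑ j : Fin N, p j x = 1 := fun x => by
    rw [← Finset.sum_range (fun j => p j x)]; exact h3 x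
  have h4' : ∀ x, (Finset.univ.filter fun j : Fin N => p j x ≠ 0).card ≤ n + 1 := fun x => by
    refine le_trans ?_ (h4 x)
    apply Finset.card_le_card_of_injOn (fun j : Fin N => (j : ℕ))
    · intro j hj
      simpa using hj
    · exact Fin.val_injective.injOn
  refine ⟨fun x => ∑ j : Fin N, p j x • w j, ?_, ?_, ?_, ?_⟩
  · exact continuous_finsetSum _ fun j _ => (h1 j j.2).smul continuous_const
  · intro x i
    simp only [Finset.sum_apply, Pi.smul_apply, smul_eq_mul]
    constructor
    · exact Finset.sum_nonneg fun j _ => mul_nonneg (h2 _ _) (hw j i).1.1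
    · rw [← h3' x]
      exact Finset.sum_le_sum fun j _ => mul_le_of_le_one_right (h2 _ _) (hw j i).1.2
  · intro x i
    simp only [Finset.sum_apply, Pi.smul_apply, smul_eq_mul]
    have e : (∑ j : Fin N, p j x * w j i) - f₀ x i = ∑ j : Fin N, p j x * (w j i - f₀ x i) := by
      simp only [mul_sub, Finset.sum_sub_distrib, ← Finset.sum_mul, h3' x, one_mul]
    have e2 : δ = ∑ j : Fin N, p j x * δ := by rw [← Finset.sum_mul, h3' x, one_mul]
    rw [e]
    refine (Finset.abs_sum_le_sum_abs _ _).trans ?_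
    rw [e2]
    refine Finset.sum_le_sum fun j _ => ?_
    rw [abs_mul, abs_of_nonneg (h2 _ _)]
    by_cases hj : p j x = 0
    · simp [hj]
    · apply mul_le_mul_of_nonneg_left _ (h2 _ _)
      have a1 := hv2 j x hj i
      have a2 := (hw j i).2
      have a3 := abs_sub_le (w j i) (v j i) (f₀ x i)
      linarith
  · intro x y hxy
    have hc := hgp (fun j => p j x - p j y) (by rw [Finset.sum_sub_distrib, h3', h3', sub_self])
      (by simp only [sub_smul]; rw [Finset.sum_sub_distrib, sub_eq_zero]; exact hxy) (by
        have hsub : (Finset.univ.filter fun j : Fin N => p j x - p j y ≠ 0) ⊆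
            (Finset.univ.filter fun j : Fin N => p j x ≠ 0) ∪
            (Finset.univ.filter fun j : Fin N => p j y ≠ 0) := by
          intro j hj
          simp only [Finset.mem_filter, Finset.mem_univ, true_and, Finset.mem_union] at hj ⊢
          by_contra hcon
          push Not at hcon
          exact hj (by rw [hcon.1, hcon.2, sub_self])
        have b1 := (Finset.card_le_card hsub).trans (Finset.card_union_le _ _)
        have b2 := h4' x
        have b3 := h4' y
        omega)
    obtain ⟨j, _, hj⟩ := Finset.exists_ne_zero_of_sum_ne_zero (s := Finset.univ)
      (f := fun j : Fin N => p j x) (by rw [h3' x]; exact one_ne_zero)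
    have := congrFun hc j
    simp only [Pi.zero_apply] at this
    exact h5 j j.2 x y hj (by rw [← sub_eq_zero.1 this]; exact hj)

lemma embed_orbit {G X : Type*} [Group G] [MetricSpace X] (α : GAction G X) (m : ℕ) (ε δ : ℝ)
    (hδ : 0 < δ) (f₀ : X → Fin m → unitInterval)
    (hf₀ : ∀ x y, dist x y ≤ ε → dist (f₀ x) (f₀ y) ≤ δ / 2) (S : Finset G) (n : ℕ)
    (hS : PU (ORel α ε S) n) (hn : 2 * n < m * S.card) :
    ∃ H : X → G → Fin m → unitInterval, (∀ g, Continuous fun x => H x g) ∧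
      (∀ x, ∀ g ∈ S, dist (H x g) (f₀ (α.act g x)) ≤ δ) ∧
      ∀ x y, (∀ g ∈ S, H x g = H y g) → ORel α ε S x y := by
  classical
  obtain ⟨f, hfc, hf1, hf2, hf3⟩ := embed (ι := S × Fin m) hS (by simpa [mul_comm] using hn)
    (fun x z => (f₀ (α.act z.1 x) z.2 : ℝ)) (fun x z => (f₀ (α.act z.1 x) z.2).2) δ hδ
    (fun x y hxy z => by
      have := hf₀ _ _ (hxy z.1 z.1.2)
      have h2 := (dist_le_pi_dist (f₀ (α.act z.1 x)) (f₀ (α.act z.1 y)) z.2).trans this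
      rwa [Subtype.dist_eq, Real.dist_eq] at h2)
  refine ⟨fun x g k => if h : g ∈ S then ⟨f x (⟨g, h⟩, k), hf1 _ _⟩ else 0, ?_, ?_, ?_⟩
  · intro g
    by_cases h : g ∈ S
    · simp only [h, dite_true]
      refine continuous_pi fun k => Continuous.subtype_mk ((continuous_apply _).comp hfc) _
    · simp only [h, dite_false]
      exact continuous_const
  · intro x g hg
    rw [dist_pi_le_iff hδ.le]
    intro k
    simp only [hg, dite_true]
    rw [Subtype.dist_eq, Real.dist_eq]
    exact hf2 x (⟨g, hg⟩, k)
  · intro x y h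
    apply hf3
    funext z
    have := congrFun (h z.1 z.1.2) z.2
    simpa using this

end Main

theorem stmt14 {G X Y : Type*} [Group G] [Countable G] [MetricSpace X] [CompactSpace X]
    [TopologicalSpace Y] [CompactSpace Y] [TopologicalSpace.MetrizableSpace Y]
    [TotallyDisconnectedSpace Y] (m : ℕ) (hm : 1 ≤ m)
    (Fseq : ℕ → Finset G) (hFseq : IsFolnerSeq Fseq)
    (α : GAction G X) (hα : ∀ g, Continuous (α.act g))
    (β : GAction G Y) (hβ : ∀ g, Continuous (β.act g)) (hAF : IsAlmostFinite β)
    (π : X → Y) (hπ : Continuous π) (hπs : Function.Surjective π)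
    (hπe : ∀ g x, π (α.act g x) = β.act g (π x))
    (hmdim : mdim α dist Fseq < (m : ℝ≥0∞) / 2) :
    ∀ η : ℝ, 0 < η →
      Dense {f : C(X, Fin m → unitInterval) |
        IsEpsEmbedding (fun x => (Ifun α (⇑f) x, π x)) η} := by
  classical
  intro η hη
  rw [Metric.dense_iff]
  intro f₀ r hr
  obtain ⟨ε₀, hε₀, hε₁⟩ := Metric.uniformContinuous_iff.1
    (CompactSpace.uniformContinuous_of_continuous f₀.continuous) (r / 4) (by positivity)
  have hε : 0 < min (ε₀ / 2) (η / 2) := by positivity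
  have hεη : min (ε₀ / 2) (η / 2) < η := (min_le_right _ _).trans_lt (by linarith)
  have hεε : min (ε₀ / 2) (η / 2) < ε₀ := (min_le_left _ _).trans_lt (by linarith)
  set ε := min (ε₀ / 2) (η / 2)
  obtain ⟨K, δ, hδ, hK⟩ := good_inv m Fseq hFseq α hα hmdim ε hε
  obtain ⟨ι, _, W, S, hW, hS, hdis, hcov⟩ := hAF K δ hδ
  have hH : ∀ i, ∃ H : X → G → Fin m → unitInterval, (∀ g, Continuous fun x => H x g) ∧
      (∀ x, ∀ g ∈ S i, dist (H x g) (f₀ (α.act g x)) ≤ r / 2) ∧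
      ∀ x y, (∀ g ∈ S i, H x g = H y g) → ORel α ε (S i) x y := by
    intro i
    obtain ⟨n, hn1, hn2⟩ := hK (S i) (hS i).1 (hS i).2
    exact embed_orbit α m ε (r / 2) (by positivity) f₀
      (fun x y hxy => by
        have := hε₁ (hxy.trans_lt hεε)
        linarith) (S i) n hn1 hn2
  choose H hHc hHd hHi using hH
  have hloc : ∀ y : Y, ∃ z : ι × G, z.2 ∈ S z.1 ∧ y ∈ β.act z.2 '' W z.1 := by
    intro y
    have : y ∈ ⋃ i, ⋃ s ∈ S i, β.act s '' W i := by rw [hcov]; trivial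
    simp only [Set.mem_iUnion] at this
    obtain ⟨i, s, hs, hy⟩ := this
    exact ⟨(i, s), hs, hy⟩
  choose z hz1 hz2 using hloc
  have huniq : ∀ y i s, s ∈ S i → y ∈ β.act s '' W i → z y = (i, s) := by
    intro y i s hs hy
    by_contra hne
    refine Set.disjoint_left.1 (hdis (z y).1 i (z y).2 (hz1 y) s hs ?_) (hz2 y) hy
    rintro ⟨e1, e2⟩
    exact hne (Prod.ext e1 e2)
  have hinvα : ∀ s x, α.act s (α.act s⁻¹ x) = x := fun s x => by
    rw [← α.act_mul, mul_inv_cancel, α.act_one]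
  have hinvβ : ∀ s x, β.act s (β.act s⁻¹ x) = x := fun s x => by
    rw [← β.act_mul, mul_inv_cancel, β.act_one]
  have hinvβ' : ∀ s x, β.act s⁻¹ (β.act s x) = x := fun s x => by
    rw [← β.act_mul, inv_mul_cancel, β.act_one]
  have hinvα' : ∀ s x, α.act s⁻¹ (α.act s x) = x := fun s x => by
    rw [← α.act_mul, inv_mul_cancel, α.act_one]
  have himg : ∀ s i, IsOpen (β.act s '' W i) := by
    intro s i
    rw [Set.image_eq_preimage_of_inverse (g := β.act s⁻¹) (hinvβ' s) (hinvβ s)]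
    exact (hW i).isOpen.preimage (hβ _)
  let f : X → Fin m → unitInterval := fun x =>
    H (z (π x)).1 (α.act (z (π x)).2⁻¹ x) (z (π x)).2
  have hfz : ∀ x i s, s ∈ S i → π x ∈ β.act s '' W i → f x = H i (α.act s⁻¹ x) s := by
    intro x i s hs hx
    simp only [f, huniq _ i s hs hx]
  have hfc : Continuous f := by
    rw [continuous_iff_continuousAt]
    intro x
    have hcont : Continuous fun x' => H (z (π x)).1 (α.act (z (π x)).2⁻¹ x') (z (π x)).2 :=
      (hHc _ _).comp (hα _)
    refine hcont.continuousAt.congr ?_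
    have hnb : π ⁻¹' (β.act (z (π x)).2 '' W (z (π x)).1) ∈ nhds x :=
      ((himg _ _).preimage hπ).mem_nhds (hz2 (π x))
    filter_upwards [hnb] with x' hx'
    exact (hfz x' _ _ (hz1 _) hx').symm
  refine ⟨⟨f, hfc⟩, ?_, ?_⟩
  · rw [Metric.mem_ball]
    refine lt_of_le_of_lt ((ContinuousMap.dist_le (C := r / 2) (by positivity)).2 fun x => ?_)
      (by linarith : r / 2 < r)
    have := hHd (z (π x)).1 (α.act (z (π x)).2⁻¹ x) _ (hz1 (π x))
    rwa [hinvα] at this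
  · intro q
    refine lt_of_le_of_lt (Metric.diam_le_of_forall_dist_le hε.le ?_) hεη
    intro x hx y hy
    have hxy : (Ifun α f x, π x) = (Ifun α f y, π y) := by
      have e1 : (Ifun α f x, π x) = q := hx
      have e2 : (Ifun α f y, π y) = q := hy
      rw [e1, e2]
    rw [Prod.mk.injEq] at hxy
    obtain ⟨hI, hp⟩ := hxy
    set i := (z (π x)).1 with hi
    set s := (z (π x)).2 with hs
    have hsS : s ∈ S i := hz1 (π x)
    have hsW : π x ∈ β.act s '' W i := hz2 (π x)
    have hbase : β.act s⁻¹ (π x) ∈ W i := by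
      obtain ⟨w, hw, hw'⟩ := hsW
      rw [← hw', hinvβ']
      exact hw
    have key : ∀ x', π x' = π x → ∀ t ∈ S i, f (α.act (t * s⁻¹) x') = H i (α.act s⁻¹ x') t := by
      intro x' hx' t ht
      rw [hfz _ i t ht]
      · rw [α.act_mul, hinvα']
      · rw [hπe, hx', β.act_mul]
        exact ⟨_, hbase, rfl⟩
    have hrel := hHi i (α.act s⁻¹ x) (α.act s⁻¹ y) (fun t ht => by
      rw [← key x rfl t ht, ← key y hp.symm t ht]
      have := congrFun hI (t * s⁻¹)⁻¹
      simpa [Ifun] using this)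
    have := hrel s hsS
    rwa [hinvα, hinvα] at this
end

section
/- Let G be a countable amenable group, β : G ↷ Y an almost finite action on a compact totally disconnected metrizable space, and α : G ↷ X an action on a compact metrizable space admitting an equivariant continuous surjection π : X → Y. If mdim(X, α) < m/2 for a natural number m ≥ 1, then there exists a continuous equivariant injection X → ([0,1]^{m+1})^G, where G acts on ([0,1]^{m+1})^G by the shift. -/
open scoped Pointwise ENNReal

theorem folner_iff {G : Type*} [Group G] [DecidableEq G] (K : Finset G) (δ : ℝ) (F : Finset G) :
    IsFolnerInv K δ F ↔ (((K * F) \ F).card : ℝ) ≤ δ * F.card := by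
  unfold IsFolnerInv
  convert Iff.rfl

theorem folner_mono {G : Type*} [Group G] {K K' : Finset G} {δ δ' : ℝ} {F : Finset G}
    (h : IsFolnerInv K' δ' F) (hK : K ⊆ K') (hδ : δ' ≤ δ) : IsFolnerInv K δ F := by
  classical
  rw [folner_iff] at *
  have h1 : ((K * F) \ F).card ≤ ((K' * F) \ F).card := by
    apply Finset.card_le_card
    exact Finset.sdiff_subset_sdiff (Finset.mul_subset_mul_right hK) le_rfl
  have h1' : (((K * F) \ F).card : ℝ) ≤ ((K' * F) \ F).card := by exact_mod_cast h1
  nlinarith [Nat.cast_nonneg (α := ℝ) F.card]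

/-- maximal almost disjoint family of translates -/
theorem quasi {G : Type*} [Group G] [DecidableEq G] (F S : Finset G) (ε : ℝ)
    (hε : 0 < ε) (hε1 : ε < 1)
    (hS : 2 * ((F * S) \ S).card * F.card ≤ S.card) (hF : F.Nonempty) :
    ∃ C : Finset G, F * C ⊆ S ∧ (1 - ε) * (F.card * C.card) ≤ (F * C).card ∧
      ε / 2 * S.card ≤ (F * C).card := by
  set T := S.filter (fun c => ∀ f ∈ F, f * c ∈ S) with hT
  have hFpos : (0 : ℝ) < F.card := by exact_mod_cast hF.card_pos
  -- most of S is in T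
  have hTS : (S.card : ℝ) ≤ 2 * T.card := by
    have h1 : (S \ T) ⊆ F⁻¹ * ((F * S) \ S) := by
      intro c hc
      simp only [hT, Finset.mem_sdiff, Finset.mem_filter, not_and, not_forall] at hc
      obtain ⟨hcS, hc⟩ := hc
      obtain ⟨f, hf, hfc⟩ := hc hcS
      rw [Finset.mem_mul]
      refine ⟨f⁻¹, Finset.inv_mem_inv hf, f * c, ?_, by group⟩
      rw [Finset.mem_sdiff]
      exact ⟨Finset.mul_mem_mul hf hcS, hfc⟩
    have h2 := (Finset.card_le_card h1).trans Finset.card_mul_le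
    rw [Finset.card_inv] at h2
    have h3 : (S \ T).card + T.card = S.card :=
      Finset.card_sdiff_add_card_eq_card (Finset.filter_subset _ _)
    have : S.card ≤ 2 * T.card := by nlinarith
    exact_mod_cast this
  let P : Finset (Finset G) := T.powerset.filter
    (fun C => (1 - ε) * (F.card * C.card : ℝ) ≤ (F * C).card)
  have hP : P.Nonempty := ⟨∅, by simp [P]⟩
  obtain ⟨C, hCP, hmax⟩ := P.exists_max_image Finset.card hP
  simp only [P, Finset.mem_filter, Finset.mem_powerset] at hCP
  obtain ⟨hCT, hC⟩ := hCP
  refine ⟨C, ?_, hC, ?_⟩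
  · intro x hx
    obtain ⟨f, hf, c, hc, rfl⟩ := Finset.mem_mul.1 hx
    exact (Finset.mem_filter.1 (hCT hc)).2 f hf
  · have key : ∀ c ∈ T, ε * F.card ≤ ((F.filter (fun f => f * c ∈ F * C)).card : ℝ) := by
      intro c hc
      by_cases hcC : c ∈ C
      · have : F.filter (fun f => f * c ∈ F * C) = F := by
          rw [Finset.filter_eq_self]
          intro f hf
          exact Finset.mul_mem_mul hf hcC
        rw [this]; nlinarith
      · by_contra hlt
        push Not at hlt
        have hins : insert c C ∈ P := by
          simp only [P, Finset.mem_filter, Finset.mem_powerset]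
          refine ⟨Finset.insert_subset hc hCT, ?_⟩
          have hsub : (F * C) ∪ ((F.filter (fun f => ¬ f * c ∈ F * C)).image (· * c)) ⊆
              F * insert c C := by
            intro x hx
            rcases Finset.mem_union.1 hx with hx | hx
            · exact Finset.mul_subset_mul_left (Finset.subset_insert _ _) hx
            · obtain ⟨f, hf, rfl⟩ := Finset.mem_image.1 hx
              exact Finset.mul_mem_mul (Finset.mem_filter.1 hf).1 (Finset.mem_insert_self _ _)
          have hdisj : Disjoint (F * C) ((F.filter (fun f => ¬ f * c ∈ F * C)).image (· * c)) := by
            rw [Finset.disjoint_right]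
            intro x hx
            obtain ⟨f, hf, rfl⟩ := Finset.mem_image.1 hx
            exact (Finset.mem_filter.1 hf).2
          have h1 := Finset.card_le_card hsub
          rw [Finset.card_union_of_disjoint hdisj,
            Finset.card_image_of_injective _ (mul_left_injective c)] at h1
          have h2 := Finset.card_filter_add_card_filter_not (s := F) (fun f => f * c ∈ F * C)
          rw [Finset.card_insert_of_notMem hcC]
          have h1' : ((F * C).card : ℝ) + (F.filter (fun f => ¬ f * c ∈ F * C)).card ≤
            (F * insert c C).card := by exact_mod_cast h1
          have h2' : ((F.filter (fun f => f * c ∈ F * C)).card : ℝ) +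
            (F.filter (fun f => ¬ f * c ∈ F * C)).card = F.card := by exact_mod_cast h2
          push_cast
          nlinarith
        have := hmax _ hins
        rw [Finset.card_insert_of_notMem hcC] at this
        omega
    -- double counting
    have hdc : ∑ c ∈ T, (F.filter (fun f => f * c ∈ F * C)).card ≤ F.card * (F * C).card := by
      have : ∀ c ∈ T, (F.filter (fun f => f * c ∈ F * C)).card =
          ∑ f ∈ F, if f * c ∈ F * C then 1 else 0 := by
        intro c _
        rw [Finset.card_filter]
      rw [Finset.sum_congr rfl this, Finset.sum_comm]
      rw [← smul_eq_mul]
      apply Finset.sum_le_card_nsmul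
      intro f _
      rw [← Finset.card_filter]
      apply Finset.card_le_card_of_injOn (fun c => f * c)
      · intro c hc
        exact (Finset.mem_filter.1 hc).2
      · intro a _ b _ hab
        exact mul_left_cancel hab
    have h1 : (T.card : ℝ) * (ε * F.card) ≤ F.card * (F * C).card := by
      calc (T.card : ℝ) * (ε * F.card) = ∑ c ∈ T, ε * F.card := by simp
        _ ≤ ∑ c ∈ T, ((F.filter (fun f => f * c ∈ F * C)).card : ℝ) := Finset.sum_le_sum key
        _ ≤ _ := by exact_mod_cast hdc
    have h2 : (T.card : ℝ) * ε ≤ (F * C).card := by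
      apply le_of_mul_le_mul_left _ hFpos
      linarith
    nlinarith

theorem card_inv_bound {G : Type*} [Group G] [DecidableEq G] (K F C S : Finset G)  :
    ((K * (S \ (F * C))) \ (S \ (F * C))).card ≤
      ((K * S) \ S).card + K.card * (((K⁻¹ * F) \ F).card * C.card) := by
  have hsub : (K * (S \ (F * C))) \ (S \ (F * C)) ⊆
      ((K * S) \ S) ∪ K * (((K⁻¹ * F) \ F) * C) := by
    intro x hx
    rw [Finset.mem_sdiff] at hx
    obtain ⟨hx1, hx2⟩ := hx
    obtain ⟨k, hk, a, ha, rfl⟩ := Finset.mem_mul.1 hx1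
    rw [Finset.mem_sdiff] at ha hx2
    rw [Finset.mem_union]
    by_cases hS : k * a ∈ S
    · right
      have : k * a ∈ F * C := by
        by_contra hn
        exact hx2 ⟨hS, hn⟩
      obtain ⟨f, hf, c, hc, hfc⟩ := Finset.mem_mul.1 this
      refine Finset.mul_mem_mul hk ?_
      have hac : a = (k⁻¹ * f) * c := by rw [mul_assoc, hfc]; group
      rw [hac]
      refine Finset.mul_mem_mul ?_ hc
      rw [Finset.mem_sdiff]
      refine ⟨Finset.mul_mem_mul (Finset.inv_mem_inv hk) hf, ?_⟩
      intro hF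
      exact ha.2 (hac ▸ Finset.mul_mem_mul hF hc)
    · left
      rw [Finset.mem_sdiff]
      exact ⟨Finset.mul_mem_mul hk ha.1, hS⟩
  refine (Finset.card_le_card hsub).trans ((Finset.card_union_le _ _).trans ?_)
  gcongr
  refine Finset.card_mul_le.trans ?_
  gcongr
  exact Finset.card_mul_le

section OW
variable {G : Type*} [Group G] [DecidableEq G] (h : Finset G → ℝ)

theorem h_mul_le (h0 : ∀ A, 0 ≤ h A)
    (hsub : ∀ A B, h (A ∪ B) ≤ h A + h B) (hempty : h ∅ ≤ 0)
    (htr : ∀ A c, h (A.image (· * c)) = h A) (F C : Finset G) : h (F * C) ≤ C.card * h F := by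
  induction C using Finset.induction_on with
  | empty => simpa using hempty
  | insert c C hc ih =>
    rw [Finset.insert_eq, Finset.mul_union, ← Finset.insert_eq, Finset.card_insert_of_notMem hc,
      Finset.mul_singleton]
    refine (hsub _ _).trans ?_
    have e : (MulOpposite.op c • F : Finset G) = F.image (· * c) := by
      ext x; simp only [Finset.mem_smul_finset, Finset.mem_image, MulOpposite.smul_eq_mul_unop,
        MulOpposite.unop_op]
    rw [e, htr]
    push_cast
    linarith

theorem ow_step_s15 (h0 : ∀ A, 0 ≤ h A)
    (hsub : ∀ A B, h (A ∪ B) ≤ h A + h B) (hempty : h ∅ ≤ 0)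
    (htr : ∀ A c, h (A.image (· * c)) = h A)
    (Fseq : ℕ → Finset G) (hF : IsFolnerSeq Fseq) (L : ℝ) (hL0 : 0 ≤ L)
    (hL : ∃ N, ∀ n ≥ N, h (Fseq n) ≤ L * (Fseq n).card)
    (ε : ℝ) (hε : 0 < ε) (hε1 : ε ≤ 1 / 2) (c D : ℝ) (hc : 0 ≤ c) (hD : 0 ≤ D)
    (hcA : ∀ A, h A ≤ c * A.card)
    (K : Finset G) (δ : ℝ) (hδ : 0 < δ)
    (hK : ∀ S : Finset G, IsFolnerInv K δ S → h S ≤ (L / (1 - ε) + D) * S.card) :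
    ∃ (K' : Finset G) (δ' : ℝ), 0 < δ' ∧ ∀ S : Finset G, IsFolnerInv K' δ' S →
      h S ≤ (L / (1 - ε) + max (c * ε) ((1 - ε / 2) * D)) * S.card := by
  obtain ⟨N, hN⟩ := hL
  obtain ⟨N', hN'⟩ := hF.2 (K⁻¹) (ε * δ / (4 * (K.card + 1))) (by positivity)
  set F := Fseq (max N N') with hFdef
  have hFne : F.Nonempty := hF.1 _
  have hFL : h F ≤ L * F.card := hN _ (le_max_left _ _)
  have hFK := hN' (max N N') (le_max_right _ _)
  rw [← hFdef, folner_iff] at hFK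
  have hFpos : (0 : ℝ) < F.card := by exact_mod_cast hFne.card_pos
  refine ⟨K ∪ F, min (ε * δ / 2) (1 / (2 * F.card)), by positivity, fun S hS => ?_⟩
  have hS1 : IsFolnerInv K (ε * δ / 2) S := folner_mono hS Finset.subset_union_left (min_le_left _ _)
  have hS2 : IsFolnerInv F (1 / (2 * F.card)) S :=
    folner_mono hS Finset.subset_union_right (min_le_right _ _)
  rw [folner_iff] at hS1 hS2
  have hS3 : 2 * ((F * S) \ S).card * F.card ≤ S.card := by
    have : (2 * ((F * S) \ S).card * F.card : ℝ) ≤ S.card := by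
      calc (2 * ((F * S) \ S).card * F.card : ℝ) ≤ 2 * (1 / (2 * F.card) * S.card) * F.card := by gcongr
        _ = S.card := by field_simp
    exact_mod_cast this
  obtain ⟨C, hCS, hC1, hC2⟩ := quasi F S ε hε (by linarith) hS3 hFne
  set U := F * C with hU
  set A := S \ U with hA
  have hUA : U ∪ A = S := by rw [hA]; exact Finset.union_sdiff_of_subset hCS
  have hcard : (A.card : ℝ) + U.card = S.card := by
    exact_mod_cast Finset.card_sdiff_add_card_eq_card hCS
  have h1 : h S ≤ h U + h A := by
    have := hsub U A; rwa [hUA] at this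
  have h1e : 0 < 1 - ε := by linarith
  have h2 : h U ≤ L / (1 - ε) * U.card := by
    calc h U ≤ C.card * h F := h_mul_le h h0 hsub hempty htr F C
      _ ≤ C.card * (L * F.card) := by gcongr
      _ = L / (1 - ε) * ((1 - ε) * (F.card * C.card)) := by field_simp
      _ ≤ _ := by gcongr
  have hL' : 0 ≤ L / (1 - ε) := by positivity
  by_cases hsm : (A.card : ℝ) ≤ ε * S.card
  · have h3 : h A ≤ c * (ε * S.card) := (hcA A).trans (by gcongr)
    have h4 : (c * ε) * (S.card : ℝ) ≤ max (c * ε) ((1 - ε / 2) * D) * S.card := by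
      gcongr; exact le_max_left _ _
    have h5 : L / (1 - ε) * (U.card : ℝ) ≤ L / (1 - ε) * S.card := by
      gcongr
    nlinarith
  · push Not at hsm
    have hinv : IsFolnerInv K δ A := by
      rw [folner_iff]
      have hb : ((((K * A) \ A).card : ℕ) : ℝ) ≤
        ((K * S) \ S).card + K.card * (((K⁻¹ * F) \ F).card * C.card) := by
        exact_mod_cast card_inv_bound K F C S
      have hUS : (U.card : ℝ) ≤ S.card := by linarith [Nat.cast_nonneg (α := ℝ) A.card]
      have hFC : (F.card * C.card : ℝ) ≤ 2 * S.card := by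
        have : (0:ℝ) ≤ F.card * C.card := by positivity
        nlinarith
      have hb2 : (K.card * (((K⁻¹ * F) \ F).card * C.card) : ℝ) ≤ ε * δ / 2 * S.card := by
        calc (K.card * (((K⁻¹ * F) \ F).card * C.card) : ℝ)
            ≤ (K.card + 1) * ((ε * δ / (4 * (K.card + 1)) * F.card) * C.card) := by
              gcongr
              linarith
          _ = ε * δ / 4 * (F.card * C.card) := by field_simp
          _ ≤ ε * δ / 4 * (2 * S.card) := by gcongr
          _ = _ := by ring
      calc ((((K * A) \ A).card : ℕ) : ℝ) ≤ ε * δ / 2 * S.card + ε * δ / 2 * S.card := by linarith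
        _ = δ * (ε * S.card) := by ring
        _ ≤ δ * A.card := by gcongr
    have h3 := hK A hinv
    have h4 : ((1 - ε / 2) * D) * (S.card : ℝ) ≤ max (c * ε) ((1 - ε / 2) * D) * S.card := by
      gcongr; exact le_max_right _ _
    have h5 : D * (A.card : ℝ) ≤ D * ((1 - ε / 2) * S.card) := by
      gcongr; linarith
    have h6 : L / (1 - ε) * (U.card : ℝ) + L / (1 - ε) * A.card = L / (1 - ε) * S.card := by
      rw [← hcard]; ring
    nlinarith

theorem ow_s15 (h0 : ∀ A, 0 ≤ h A)
    (hsub : ∀ A B, h (A ∪ B) ≤ h A + h B) (hempty : h ∅ ≤ 0)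
    (htr : ∀ A c, h (A.image (· * c)) = h A)
    (Fseq : ℕ → Finset G) (hF : IsFolnerSeq Fseq) (L : ℝ) (hL0 : 0 ≤ L)
    (hL : ∃ N, ∀ n ≥ N, h (Fseq n) ≤ L * (Fseq n).card) (θ : ℝ) (hθ : 0 < θ) :
    ∃ (K : Finset G) (δ : ℝ), 0 < δ ∧ ∀ S : Finset G, IsFolnerInv K δ S →
      h S ≤ (L + θ) * S.card := by
  set c := h {1} with hc
  have hc0 : 0 ≤ c := h0 _
  have hcA : ∀ A, h A ≤ c * A.card := by
    intro A
    have := h_mul_le h h0 hsub hempty htr {1} A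
    rw [Finset.singleton_one, one_mul] at this
    rw [mul_comm]; exact this
  -- choose ε
  obtain ⟨ε, hε, hε1, hεL, hεc⟩ : ∃ ε : ℝ, 0 < ε ∧ ε ≤ 1 / 2 ∧ L / (1 - ε) ≤ L + θ / 2 ∧
      c * ε ≤ θ / 2 := by
    refine ⟨min (1 / 2) (min (θ / (2 * (2 * L + θ + 1))) (θ / (2 * (c + 1)))), by positivity,
      min_le_left _ _, ?_, ?_⟩
    · set ε := min (1 / 2 : ℝ) (min (θ / (2 * (2 * L + θ + 1))) (θ / (2 * (c + 1))))
      have h1 : ε ≤ 1 / 2 := min_le_left _ _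
      have h2 : ε ≤ θ / (2 * (2 * L + θ + 1)) := (min_le_right _ _).trans (min_le_left _ _)
      rw [div_le_iff₀ (by linarith)]
      rw [le_div_iff₀ (by positivity)] at h2
      have : 0 < ε := by positivity
      nlinarith
    · set ε := min (1 / 2 : ℝ) (min (θ / (2 * (2 * L + θ + 1))) (θ / (2 * (c + 1))))
      have h2 : ε ≤ θ / (2 * (c + 1)) := (min_le_right _ _).trans (min_le_right _ _)
      rw [le_div_iff₀ (by positivity)] at h2
      have : 0 < ε := by positivity
      nlinarith
  have hind : ∀ k : ℕ, ∃ (K : Finset G) (δ : ℝ), 0 < δ ∧ ∀ S : Finset G, IsFolnerInv K δ S →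
      h S ≤ (L / (1 - ε) + max (c * ε) ((1 - ε / 2) ^ k * c)) * S.card := by
    intro k
    have hL' : 0 ≤ L / (1 - ε) := div_nonneg hL0 (by linarith)
    induction k with
    | zero =>
      refine ⟨∅, 1, one_pos, fun S _ => (hcA S).trans ?_⟩
      gcongr
      simp only [pow_zero, one_mul]
      linarith [le_max_right (c * ε) c]
    | succ k ih =>
      obtain ⟨K, δ, hδ, hK⟩ := ih
      obtain ⟨K', δ', hδ', hK'⟩ := ow_step_s15 h h0 hsub hempty htr Fseq hF L hL0 hL ε hε hε1 c _ hc0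
        (le_max_of_le_left (by positivity)) hcA K δ hδ hK
      refine ⟨K', δ', hδ', fun S hS => (hK' S hS).trans ?_⟩
      refine mul_le_mul_of_nonneg_right (add_le_add le_rfl ?_) (Nat.cast_nonneg _)
      apply max_le (le_max_left _ _)
      rw [mul_max_of_nonneg _ _ (by linarith)]
      apply max_le
      · apply le_max_of_le_left
        have : 0 ≤ c * ε := by positivity
        nlinarith
      · apply le_max_of_le_right
        rw [pow_succ]
        apply le_of_eq; ring
  obtain ⟨k, hk⟩ := exists_pow_lt_of_lt_one (show (0 : ℝ) < θ / (2 * (c + 1)) by positivity)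
    (show 1 - ε / 2 < 1 by linarith)
  obtain ⟨K, δ, hδ, hK⟩ := hind k
  refine ⟨K, δ, hδ, fun S hS => (hK S hS).trans ?_⟩
  refine mul_le_mul_of_nonneg_right ?_ (Nat.cast_nonneg _)
  have : max (c * ε) ((1 - ε / 2) ^ k * c) ≤ θ / 2 := by
    apply max_le hεc
    rw [lt_div_iff₀ (by positivity)] at hk
    have : 0 ≤ (1 - ε / 2) ^ k := pow_nonneg (by linarith) _
    nlinarith
  linarith
end OW

section GP
variable {V H : Type*} [NormedAddCommGroup V] [NormedSpace ℝ V] [FiniteDimensional ℝ V]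
  [NormedAddCommGroup H] [NormedSpace ℝ H] [FiniteDimensional ℝ H]

theorem gp_step (g : V → H) (hg : ContDiff ℝ 1 g) (ℓ : V →L[ℝ] ℝ) {J : Type*} [Finite J]
    (a : J → V) (W : J → Submodule ℝ V) (n : ℕ) (hW : ∀ j, Module.finrank ℝ (W j) ≤ n)
    (hn : 2 * n < Module.finrank ℝ H) (η : ℝ) (hη : 0 < η) :
    ∃ w : H, ‖w‖ < η ∧ ∀ p q, (∃ j, p - a j ∈ W j) → (∃ j, q - a j ∈ W j) →
      g p + ℓ p • w = g q + ℓ q • w → ℓ p = ℓ q := by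
  let Ψ : ∀ j : J × J, (W j.1 × W j.2) → H := fun j u =>
    -(ℓ (a j.1 + u.1) - ℓ (a j.2 + u.2))⁻¹ • (g (a j.1 + u.1) - g (a j.2 + u.2))
  let s : ∀ j : J × J, Set (W j.1 × W j.2) := fun j =>
    {u | 0 < ℓ (a j.1 + u.1) - ℓ (a j.2 + u.2)}
  have hdim : ∀ j, dimH (Ψ j '' s j) ≤ (2 * n : ℕ) := by
    intro j
    have hc : ContDiffOn ℝ 1 (Ψ j) (s j) := by
      have h1 : ContDiff ℝ 1 (fun u : W j.1 × W j.2 => a j.1 + (u.1 : V)) :=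
        contDiff_const.add ((W j.1).subtypeL.contDiff.comp contDiff_fst)
      have h2 : ContDiff ℝ 1 (fun u : W j.1 × W j.2 => a j.2 + (u.2 : V)) :=
        contDiff_const.add ((W j.2).subtypeL.contDiff.comp contDiff_snd)
      refine ContDiffOn.smul ?_ ((hg.comp h1).sub (hg.comp h2)).contDiffOn
      refine ContDiffOn.neg (ContDiffOn.inv ?_ ?_)
      · exact ((ℓ.contDiff.comp h1).sub (ℓ.contDiff.comp h2)).contDiffOn
      · intro u hu
        exact ne_of_gt hu
    have hconv : Convex ℝ (s j) := by
      intro u hu v hv c d hc hd hcd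
      simp only [s, Set.mem_ofPred_eq] at hu hv ⊢
      have e1 : ℓ (a j.1 + ((c • u + d • v).1 : W j.1)) - ℓ (a j.2 + ((c • u + d • v).2 : W j.2))
        = c * (ℓ (a j.1 + u.1) - ℓ (a j.2 + u.2)) + d * (ℓ (a j.1 + v.1) - ℓ (a j.2 + v.2)) := by
        have hd' : d = 1 - c := by linarith
        subst hd'
        simp
        ring
      rw [e1]
      rcases hc.lt_or_eq with hc | hc
      · have := mul_pos hc hu
        have := mul_nonneg hd hv.le
        linarith
      · have : d = 1 := by linarith
        subst this; rw [← hc]; linarith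
    refine (hc.dimH_image_le hconv subset_rfl).trans ((dimH_mono (Set.subset_univ _)).trans ?_)
    rw [Real.dimH_univ_eq_finrank, Module.finrank_prod]
    have := hW j.1
    have := hW j.2
    exact_mod_cast (by omega : _ + _ ≤ 2 * n)
  have hd : dimH (⋃ j, Ψ j '' s j) < Module.finrank ℝ H := by
    rw [dimH_iUnion]
    refine (iSup_le hdim).trans_lt ?_
    exact_mod_cast hn
  have hdense := dense_compl_of_dimH_lt_finrank hd
  obtain ⟨w, hw1, hw2⟩ := hdense.exists_dist_lt 0 hη
  refine ⟨w, by simpa using hw2, ?_⟩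
  have key : ∀ p q, (∃ j, p - a j ∈ W j) → (∃ j, q - a j ∈ W j) →
      g p + ℓ p • w = g q + ℓ q • w → ¬ (0 < ℓ p - ℓ q) := by
    rintro p q ⟨j, hj⟩ ⟨k, hk⟩ he hlt
    apply hw1
    rw [Set.mem_iUnion]
    refine ⟨(j, k), (⟨_, hj⟩, ⟨_, hk⟩), ?_, ?_⟩
    · simpa [s] using hlt
    · simp only [Ψ, add_sub_cancel]
      have h1 : g p - g q = -((ℓ p - ℓ q) • w) := by
        rw [sub_smul, neg_sub, sub_eq_sub_iff_add_eq_add, he, add_comm]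
      rw [h1, neg_smul, smul_neg, neg_neg, smul_smul, inv_mul_cancel₀ hlt.ne', one_smul]
  intro p q hp hq he
  have h1 := key p q hp hq he
  have h2 := key q p hq hp he.symm
  linarith

theorem gp_all {J : Type*} [Finite J]
    (a : J → V) (W : J → Submodule ℝ V) (n : ℕ) (hW : ∀ j, Module.finrank ℝ (W j) ≤ n)
    (hn : 2 * n < Module.finrank ℝ H) (P : Set V) (hP : IsCompact P) (T : Finset (V →L[ℝ] ℝ)) 
    (g : V → H) (hg : ContDiff ℝ 1 g) :
    ∀ (η : ℝ) (_ : 0 < η), 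
    ∃ g' : V → H, ContDiff ℝ 1 g' ∧ (∀ p ∈ P, ‖g' p - g p‖ ≤ η) ∧
      ∀ p q, (∃ j, p - a j ∈ W j) → (∃ j, q - a j ∈ W j) → g' p = g' q → ∀ ℓ ∈ T, ℓ p = ℓ q := by
  classical
  induction T using Finset.induction_on with
  | empty => 
    intro η hη
    exact ⟨g, hg, fun p _ => by simpa using hη.le, by simp⟩
  | insert ℓ T _ ih =>
    intro η hη
    obtain ⟨g1, hg1, hg1n, hg1e⟩ := ih (η / 2) (by positivity)
    obtain ⟨R, hR⟩ := hP.exists_bound_of_continuousOn ℓ.continuous.continuousOn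
    obtain ⟨w, hw, hwe⟩ := gp_step g1 hg1 ℓ a W n hW hn (η / (2 * (|R| + 1))) (by positivity)
    refine ⟨fun p => g1 p + ℓ p • w, hg1.add (ℓ.contDiff.smul contDiff_const), ?_, ?_⟩
    · intro p hp
      have e : g1 p + ℓ p • w - g p = (g1 p - g p) + ℓ p • w := by abel
      rw [e]
      have h1 : ‖ℓ p • w‖ ≤ η / 2 := by
        rw [norm_smul]
        calc ‖ℓ p‖ * ‖w‖ ≤ (|R| + 1) * (η / (2 * (|R| + 1))) := by
              gcongr
              linarith [hR p hp, le_abs_self R]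
          _ = η / 2 := by field_simp
      linarith [norm_add_le (g1 p - g p) (ℓ p • w), hg1n p hp]
    · intro p q hp hq he
      have h1 := hwe p q hp hq he
      simp only [h1, add_left_inj] at he
      intro k hk
      rcases Finset.mem_insert.1 hk with rfl | hk
      · exact h1
      · exact hg1e p q hp hq he k hk

theorem gp_s15 {J : Type*} [Finite J]
    (a : J → V) (W : J → Submodule ℝ V) (n : ℕ) (hW : ∀ j, Module.finrank ℝ (W j) ≤ n)
    (hn : 2 * n < Module.finrank ℝ H) (P : Set V) (hP : IsCompact P) 
    (g : V → H) (hg : ContDiff ℝ 1 g) (η : ℝ) (hη : 0 < η) :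
    ∃ g' : V → H, ContDiff ℝ 1 g' ∧ (∀ p ∈ P, ‖g' p - g p‖ ≤ η) ∧
      ∀ p q, (∃ j, p - a j ∈ W j) → (∃ j, q - a j ∈ W j) → g' p = g' q → p = q := by
  classical
  let b := Module.finBasis ℝ V
  let T : Finset (V →L[ℝ] ℝ) := Finset.univ.image (fun i => (b.coord i).toContinuousLinearMap)
  obtain ⟨g', h1, h2, h3⟩ := gp_all a W n hW hn P hP T g hg η hη
  refine ⟨g', h1, h2, fun p q hp hq he => ?_⟩
  apply b.ext_elem
  intro i
  have := h3 p q hp hq he ((b.coord i).toContinuousLinearMap)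
    (Finset.mem_image_of_mem _ (Finset.mem_univ i))
  simpa using this

open Topology Manifold in
theorem smooth_approx {X : Type*} [TopologicalSpace X] [CompactSpace X] (φ : X → V)
    (hφ : Continuous φ) (f : X → H) (hf : Continuous f) (η : ℝ) (hη : 0 < η)
    (hfib : ∀ x y, φ x = φ y → dist (f x) (f y) ≤ η) :
    ∃ g : V → H, ContDiff ℝ 1 g ∧ ∀ x, ‖g (φ x) - f x‖ ≤ 2 * η := by
  let t : V → Set H := fun p => {v | ∀ x, φ x = p → v ∈ Metric.closedBall (f x) (2 * η)}
  have ht : ∀ p, Convex ℝ (t p) := by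
    intro p
    have : t p = ⋂ x, ⋂ (_ : φ x = p), Metric.closedBall (f x) (2 * η) := by
      ext v; simp [t]
    rw [this]
    exact convex_iInter fun x => convex_iInter fun _ => convex_closedBall _ _
  have hloc : ∀ p : V, ∃ c : H, ∀ᶠ y in 𝓝 p, c ∈ t y := by
    intro p
    by_cases hp : ∃ x, φ x = p
    · obtain ⟨x0, rfl⟩ := hp
      refine ⟨f x0, ?_⟩
      have hcl : IsClosed (φ '' {x | 2 * η ≤ dist (f x0) (f x)}) :=
        ((isClosed_le continuous_const (continuous_const.dist hf)).isCompact.image hφ).isClosed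
      have hmem : (φ '' {x | 2 * η ≤ dist (f x0) (f x)})ᶜ ∈ 𝓝 (φ x0) := by
        apply hcl.isOpen_compl.mem_nhds
        rintro ⟨x, hx, hxe⟩
        have := hfib x0 x hxe.symm
        simp only [Set.mem_ofPred_eq] at hx
        linarith
      filter_upwards [hmem] with y hy x hx
      rw [Metric.mem_closedBall]
      by_contra hlt
      exact hy ⟨x, by simp only [Set.mem_ofPred_eq]; linarith, hx⟩
    · refine ⟨0, ?_⟩
      have hcl : IsClosed (Set.range φ) := (isCompact_range hφ).isClosed
      filter_upwards [hcl.isOpen_compl.mem_nhds (show p ∈ (Set.range φ)ᶜ from hp)] with y hy x hx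
      exact absurd ⟨x, hx⟩ hy
  obtain ⟨g, hg⟩ := exists_contMDiffMap_forall_mem_convex_of_local_const (n := 1) 𝓘(ℝ, V) ht hloc
  refine ⟨g, g.contMDiff.contDiff, fun x => ?_⟩
  have := hg (φ x) x rfl
  rwa [Metric.mem_closedBall, dist_eq_norm] at this

theorem embed_approx {X : Type*} [TopologicalSpace X] [CompactSpace X] (φ : X → V)
    (hφ : Continuous φ) {J : Type*} [Finite J]
    (a : J → V) (W : J → Submodule ℝ V) (n : ℕ) (hW : ∀ j, Module.finrank ℝ (W j) ≤ n)
    (hn : 2 * n < Module.finrank ℝ H) (hcov : ∀ x, ∃ j, φ x - a j ∈ W j)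
    (f : X → H) (hf : Continuous f) (η : ℝ) (hη : 0 < η)
    (hfib : ∀ x y, φ x = φ y → dist (f x) (f y) ≤ η) :
    ∃ g : X → H, Continuous g ∧ (∀ x, dist (g x) (f x) ≤ 3 * η) ∧
      ∀ x y, g x = g y → φ x = φ y := by
  obtain ⟨g0, hg0, hg0f⟩ := smooth_approx φ hφ f hf η hη hfib
  obtain ⟨g, hg, hgn, hge⟩ := gp_s15 a W n hW hn (Set.range φ) (isCompact_range hφ) g0 hg0 η hη
  refine ⟨g ∘ φ, hg.continuous.comp hφ, fun x => ?_, fun x y h => hge _ _ (hcov x) (hcov y) h⟩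
  have h1 := hgn (φ x) ⟨x, rfl⟩
  have h2 := hg0f x
  rw [← dist_eq_norm] at h1 h2
  show dist (g (φ x)) (f x) ≤ 3 * η
  linarith [dist_triangle (g (φ x)) (g0 (φ x)) (f x)]
end GP

universe u v

/-- existence of a map to an `n`-dimensional polyhedron, with small fibres for the `F`-metric -/
def HasDim {G : Type v} {X : Type u} [Group G] [MetricSpace X] (α : GAction G X) (ε : ℝ)
    (F : Finset G) (n : ℕ) : Prop :=
  ∃ (V : Type u) (_ : NormedAddCommGroup V) (_ : NormedSpace ℝ V) (_ : FiniteDimensional ℝ V)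
    (φ : X → V) (J : Type u) (_ : Finite J) (a : J → V) (W : J → Submodule ℝ V),
    Continuous φ ∧ (∀ j, Module.finrank ℝ (W j) ≤ n) ∧ (∀ x, ∃ j, φ x - a j ∈ W j) ∧
    ∀ x y, φ x = φ y → ∀ g ∈ F, dist (α.act g x) (α.act g y) ≤ ε

section
variable {G : Type v} {X : Type u} [Group G] [MetricSpace X]

theorem hasDim_union [DecidableEq G] {α : GAction G X} {ε : ℝ} {A B : Finset G} {n m : ℕ}
    (hA : HasDim α ε A n)
    (hB : HasDim α ε B m) : HasDim α ε (A ∪ B) (n + m) := by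
  obtain ⟨V, _, _, _, φ, J, _, a, W, h1, h2, h3, h4⟩ := hA
  obtain ⟨V', _, _, _, φ', J', _, a', W', h1', h2', h3', h4'⟩ := hB
  refine ⟨V × V', inferInstance, inferInstance, inferInstance, fun x => (φ x, φ' x), J × J',
    inferInstance, fun j => (a j.1, a' j.2), fun j => (W j.1).prod (W' j.2), h1.prodMk h1', ?_, ?_, ?_⟩
  · intro j
    let f : (W j.1).prod (W' j.2) →ₗ[ℝ] (W j.1 × W' j.2) :=
      { toFun := fun p => (⟨p.1.1, p.2.1⟩, ⟨p.1.2, p.2.2⟩)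
        map_add' := fun _ _ => rfl
        map_smul' := fun _ _ => rfl }
    have hf : Function.Injective f := by
      intro p q h
      simp only [f, LinearMap.coe_mk, AddHom.coe_mk, Prod.mk.injEq, Subtype.mk.injEq] at h
      exact Subtype.ext (Prod.ext h.1 h.2)
    have e := LinearMap.finrank_le_finrank_of_injective hf
    rw [Module.finrank_prod] at e
    exact e.trans (add_le_add (h2 _) (h2' _))
  · intro x
    obtain ⟨j, hj⟩ := h3 x
    obtain ⟨j', hj'⟩ := h3' x
    exact ⟨(j, j'), hj, hj'⟩
  · intro x y h g hg
    rw [Prod.mk.injEq] at h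
    rcases Finset.mem_union.1 hg with hg | hg
    · exact h4 x y h.1 g hg
    · exact h4' x y h.2 g hg

theorem hasDim_translate [DecidableEq G] {α : GAction G X} (hα : ∀ g, Continuous (α.act g)) {ε : ℝ}
    {A : Finset G} {n : ℕ} (hA : HasDim α ε A n) (c : G) : HasDim α ε (A.image (· * c)) n := by
  obtain ⟨V, _, _, _, φ, J, _, a, W, h1, h2, h3, h4⟩ := hA
  refine ⟨V, inferInstance, inferInstance, inferInstance, fun x => φ (α.act c x), J,
    inferInstance, a, W, h1.comp (hα c), h2, fun x => h3 _, ?_⟩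
  intro x y h g hg
  obtain ⟨g, hg', rfl⟩ := Finset.mem_image.1 hg
  rw [α.act_mul, α.act_mul]
  exact h4 _ _ h g hg'

theorem dist_le_dynMetric {α : GAction G X} {F : Finset G} {x y : X} {ε : ℝ}
    (h : dynMetric α dist F x y ≤ ε) : ∀ g ∈ F, dist (α.act g x) (α.act g y) ≤ ε := by
  intro g hg
  have h1 := Finset.le_sup (f := fun g => (dist (α.act g x) (α.act g y)).toNNReal) hg
  have h2 : dist (α.act g x) (α.act g y) ≤ dynMetric α dist F x y := by
    unfold dynMetric
    calc dist (α.act g x) (α.act g y) = ((dist (α.act g x) (α.act g y)).toNNReal : ℝ) := by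
          rw [Real.coe_toNNReal _ dist_nonneg]
      _ ≤ _ := by exact_mod_cast h1
  linarith

theorem dynMetric_le {α : GAction G X} {F : Finset G} {x y : X} {ε : ℝ} (hε : 0 ≤ ε)
    (h : ∀ g ∈ F, dist (α.act g x) (α.act g y) ≤ ε) : dynMetric α dist F x y ≤ ε := by
  unfold dynMetric
  have : (F.sup fun g => (dist (α.act g x) (α.act g y)).toNNReal) ≤ ε.toNNReal := by
    apply Finset.sup_le
    intro g hg
    exact Real.toNNReal_le_toNNReal (h g hg)
  calc _ ≤ ((ε.toNNReal : NNReal) : ℝ) := by exact_mod_cast this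
    _ = ε := Real.coe_toNNReal _ hε

theorem hasDim_of_cover {α : GAction G X} {ε : ℝ} {F : Finset G} {n : ℕ} (𝒰 : Finset (Set X))
    (h1 : ∀ U ∈ 𝒰, IsOpen U) (h2 : ∀ x : X, ∃ U ∈ 𝒰, x ∈ U)
    (h3 : ∀ U ∈ 𝒰, ∀ x ∈ U, ∀ y ∈ U, ∀ g ∈ F, dist (α.act g x) (α.act g y) ≤ ε)
    (h4 : ∀ x : X, {U : Set X | U ∈ 𝒰 ∧ x ∈ U}.ncard ≤ n + 1) : HasDim α ε F n := by
  classical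
  obtain ⟨ρ, hρ⟩ := PartitionOfUnity.exists_isSubordinate (s := (Set.univ : Set X)) isClosed_univ
    (fun U : 𝒰 => U.1) (fun U => h1 U.1 U.2)
    (fun x _ => by
      obtain ⟨U, hU, hx⟩ := h2 x
      exact Set.mem_iUnion.2 ⟨⟨U, hU⟩, hx⟩)
  have hρU : ∀ (U : 𝒰) x, ρ U x ≠ 0 → x ∈ U.1 := fun U x hx =>
    hρ U (subset_tsupport _ hx)
  have hsum : ∀ x, ∑ U, ρ U x = 1 := by
    intro x
    have := ρ.sum_eq_one (Set.mem_univ x)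
    rwa [finsum_eq_sum_of_fintype] at this
  let e : 𝒰 → (𝒰 → ℝ) := fun U => Pi.single U 1
  refine ⟨𝒰 → ℝ, inferInstance, inferInstance, inferInstance, fun x U => ρ U x,
    {j : Finset 𝒰 × 𝒰 // j.2 ∈ j.1 ∧ j.1.card ≤ n + 1}, inferInstance, fun j => e j.1.2,
    fun j => Submodule.span ℝ (((j.1.1.erase j.1.2).image (fun U => e U - e j.1.2) : Finset _) : Set (𝒰 → ℝ)),
    continuous_pi fun U => (ρ U).continuous, ?_, ?_, ?_⟩
  · rintro ⟨⟨σ, U⟩, hU, hσ⟩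
    refine (finrank_span_finset_le_card _).trans (Finset.card_image_le.trans ?_)
    simp only at hU hσ ⊢
    rw [Finset.card_erase_of_mem hU]
    omega
  · intro x
    set σ : Finset 𝒰 := Finset.univ.filter (fun U => x ∈ U.1) with hσ
    have hcard : σ.card ≤ n + 1 := by
      refine le_trans (le_of_eq ?_) (h4 x)
      rw [← Finset.card_image_of_injective σ Subtype.val_injective, ← Set.ncard_coe_finset]
      congr 1
      ext U
      simp [hσ, and_comm]
    obtain ⟨U0, hU0, hx0⟩ := h2 x
    refine ⟨⟨(σ, ⟨U0, hU0⟩), by simpa [hσ] using hx0, hcard⟩, ?_⟩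
    have heq : (fun U => ρ U x) - e ⟨U0, hU0⟩ = ∑ U, ρ U x • (e U - e ⟨U0, hU0⟩) := by
      simp only [smul_sub, Finset.sum_sub_distrib, ← Finset.sum_smul, hsum, one_smul]
      congr 1
      ext U
      simp [e, Finset.sum_apply, Pi.single_apply]
    simp only
    rw [heq]
    apply Submodule.sum_mem
    intro U _
    by_cases hU : ρ U x = 0
    · rw [hU, zero_smul]; exact Submodule.zero_mem _
    by_cases hUU : U = ⟨U0, hU0⟩
    · rw [hUU, sub_self, smul_zero]; exact Submodule.zero_mem _
    · apply Submodule.smul_mem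
      apply Submodule.subset_span
      rw [Finset.mem_coe]
      refine Finset.mem_image_of_mem (fun U => e U - e ⟨U0, hU0⟩) (Finset.mem_erase.2 ⟨hUU, ?_⟩)
      simp [hσ, hρU U x hU]
  · intro x y hxy g hg
    have : ∃ U, ρ U x ≠ 0 := by
      by_contra hn
      push Not at hn
      have := hsum x
      simp [hn] at this
    obtain ⟨U, hU⟩ := this
    have hU' : ρ U y ≠ 0 := by
      have := congrFun hxy U
      simp only at this
      rwa [← this]
    exact h3 U.1 U.2 x (hρU U x hU) y (hρU U y hU') g hg

theorem hasDim_widim [CompactSpace X] {α : GAction G X} (hα : ∀ g, Continuous (α.act g)) {ε : ℝ}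
    (hε : 0 < ε) (F : Finset G) : HasDim α ε F (widim (dynMetric α dist F) ε) := by
  classical
  have hne : {n : ℕ | ∃ 𝒰 : Finset (Set X),
    (∀ U ∈ 𝒰, IsOpen U) ∧ (∀ x : X, ∃ U ∈ 𝒰, x ∈ U) ∧
    (∀ U ∈ 𝒰, ∀ x ∈ U, ∀ y ∈ U, dynMetric α dist F x y ≤ ε) ∧
    ∀ x : X, {U : Set X | U ∈ 𝒰 ∧ x ∈ U}.ncard ≤ n + 1}.Nonempty := by
    let B : X → Set X := fun x => {y | ∀ g ∈ F, dist (α.act g x) (α.act g y) < ε / 2}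
    have hB : ∀ x, IsOpen (B x) := by
      intro x
      have : B x = ⋂ g ∈ F, {y | dist (α.act g x) (α.act g y) < ε / 2} := by
        ext y; simp [B]
      rw [this]
      apply isOpen_biInter_finset
      intro g _
      exact isOpen_lt (continuous_const.dist (hα g)) continuous_const
    obtain ⟨t, ht⟩ := isCompact_univ.elim_finite_subcover B hB (fun x _ =>
      Set.mem_iUnion.2 ⟨x, by intro g _; simpa using hε⟩)
    refine ⟨(t.image B).card, t.image B, ?_, ?_, ?_, ?_⟩
    · intro U hU
      obtain ⟨x, _, rfl⟩ := Finset.mem_image.1 hU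
      exact hB x
    · intro x
      have := ht (Set.mem_univ x)
      simp only [Set.mem_iUnion] at this
      obtain ⟨y, hy, hxy⟩ := this
      exact ⟨B y, Finset.mem_image_of_mem _ hy, hxy⟩
    · intro U hU x hx y hy
      obtain ⟨z, _, rfl⟩ := Finset.mem_image.1 hU
      apply dynMetric_le hε.le
      intro g hg
      have h1 := hx g hg
      have h2 := hy g hg
      have := dist_triangle_left (α.act g x) (α.act g y) (α.act g z)
      linarith
    · intro x
      refine le_trans ?_ (Nat.le_succ _)
      rw [← Set.ncard_coe_finset]
      exact Set.ncard_le_ncard (fun U hU => hU.1) (Finset.finite_toSet _)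
  obtain ⟨𝒰, h1, h2, h3, h4⟩ := Nat.sInf_mem hne
  exact hasDim_of_cover 𝒰 h1 h2 (fun U hU x hx y hy => dist_le_dynMetric (h3 U hU x hx y hy)) h4

theorem hasDim_empty [Nonempty X] (α : GAction G X) (ε : ℝ) : HasDim α ε ∅ 0 := by
  refine hasDim_of_cover {Set.univ} ?_ ?_ ?_ ?_
  · simp
  · simp
  · simp
  · intro x
    refine (Set.ncard_le_ncard (t := {Set.univ}) (fun U hU => ?_) (Set.finite_singleton _)).trans
      (by simp)
    simpa using hU.1

/-- the dimension function -/
noncomputable def hd (α : GAction G X) (ε : ℝ) (F : Finset G) : ℕ := sInf {n | HasDim α ε F n}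

theorem hasDim_hd [CompactSpace X] {α : GAction G X} (hα : ∀ g, Continuous (α.act g)) {ε : ℝ}
    (hε : 0 < ε) (F : Finset G) : HasDim α ε F (hd α ε F) :=
  Nat.sInf_mem (s := {n | HasDim α ε F n}) ⟨_, hasDim_widim hα hε F⟩

theorem hd_le {α : GAction G X} {ε : ℝ} {F : Finset G} {n : ℕ} (h : HasDim α ε F n) :
    hd α ε F ≤ n := Nat.sInf_le h

theorem exists_inv [CompactSpace X] [Nonempty X] {α : GAction G X}
    (hα : ∀ g, Continuous (α.act g)) (m : ℕ)
    (Fseq : ℕ → Finset G) (hFseq : IsFolnerSeq Fseq)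
    (hmdim : mdim α dist Fseq < (m : ℝ≥0∞) / 2) {ε : ℝ} (hε : 0 < ε) :
    ∃ (K : Finset G) (δ : ℝ), 0 < δ ∧ ∀ S : Finset G, S.Nonempty → IsFolnerInv K δ S →
      ∃ n, HasDim α ε S n ∧ 2 * n < m * S.card := by
  classical
  have h1 : mdimEps α dist Fseq ε < (m : ℝ≥0∞) / 2 :=
    lt_of_le_of_lt (le_iSup₂ (f := fun (ε : ℝ) (_ : 0 < ε) => mdimEps α dist Fseq ε) ε hε) hmdim
  obtain ⟨L, hL1, hL2⟩ := ENNReal.lt_iff_exists_nnreal_btwn.1 h1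
  have hev := Filter.eventually_lt_of_limsup_lt hL1
  obtain ⟨N, hN⟩ := Filter.eventually_atTop.1 hev
  have hL2' : (L : ℝ) < m / 2 := by
    have : (L : ℝ≥0∞) < (((m : NNReal) / 2 : NNReal) : ℝ≥0∞) := by
      rw [ENNReal.coe_div (by norm_num)]
      simpa using hL2
    have := ENNReal.coe_lt_coe.1 this
    exact_mod_cast this
  have hLN : ∀ n ≥ N, (hd α ε (Fseq n) : ℝ) ≤ L * (Fseq n).card := by
    intro n hn
    have h2 := hN n hn
    have hpos : 0 < (Fseq n).card := (hFseq.1 n).card_pos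
    have h3 : (widim (dynMetric α dist (Fseq n)) ε : ℝ≥0∞) ≤ L * ((Fseq n).card : ℝ≥0∞) := by
      rw [← ENNReal.div_le_iff (by exact_mod_cast hpos.ne') (by simp)]
      exact h2.le
    have h4 : (widim (dynMetric α dist (Fseq n)) ε : ℝ) ≤ L * (Fseq n).card := by
      exact_mod_cast h3
    refine le_trans ?_ h4
    exact_mod_cast hd_le (hasDim_widim hα hε (Fseq n))
  have htr : ∀ (A : Finset G) c, hd α ε (A.image (· * c)) ≤ hd α ε A := fun A c =>
    hd_le (hasDim_translate hα (hasDim_hd hα hε A) c)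
  obtain ⟨K, δ, hδ, hK⟩ := ow_s15 (fun F => (hd α ε F : ℝ)) (fun _ => Nat.cast_nonneg _)
    (fun A B => by exact_mod_cast hd_le (hasDim_union (hasDim_hd hα hε A) (hasDim_hd hα hε B)))
    (by exact_mod_cast hd_le (hasDim_empty α ε))
    (fun A c => by
      have h1 := htr A c
      have h2 := htr (A.image (· * c)) c⁻¹
      rw [Finset.image_image] at h2
      simp only [Function.comp_def, mul_inv_cancel_right, Finset.image_id'] at h2
      exact_mod_cast le_antisymm h1 h2)
    Fseq hFseq L L.2 ⟨N, hLN⟩ ((m / 2 - L) / 2) (by linarith)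
  refine ⟨K, δ, hδ, fun S hS hSK => ⟨hd α ε S, hasDim_hd hα hε S, ?_⟩⟩
  have h5 := hK S hSK
  have hpos : (0 : ℝ) < S.card := by exact_mod_cast hS.card_pos
  have h6 : (2 * hd α ε S : ℝ) < m * S.card := by
    nlinarith
  exact_mod_cast h6
end

theorem tower_map {G X : Type*} [Group G] [MetricSpace X] [CompactSpace X] {α : GAction G X}
    (hα : ∀ g, Continuous (α.act g)) {m n : ℕ} {ε η : ℝ} (hη : 0 < η) (S : Finset G)
    (hS : HasDim α ε S n) (hn : 2 * n < m * S.card) (f : X → Fin m → ℝ) (hf : Continuous f)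
    (hfε : ∀ x y, dist x y ≤ ε → dist (f x) (f y) ≤ η) :
    ∃ g : X → S → Fin m → ℝ, Continuous g ∧
      (∀ x (s : S), dist (g x s) (f (α.act s x)) ≤ 3 * η) ∧
      ∀ x y, g x = g y → ∀ s ∈ S, dist (α.act s x) (α.act s y) ≤ ε := by
  obtain ⟨V, _, _, _, φ, J, _, a, W, h1, h2, h3, h4⟩ := hS
  obtain ⟨g, hg1, hg2, hg3⟩ := embed_approx (H := S → Fin m → ℝ) φ h1 a W n h2
    (by
      rw [Module.finrank_pi_fintype]
      simpa [mul_comm] using hn) h3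
    (fun x s => f (α.act s x)) (continuous_pi fun s => hf.comp (hα s)) η hη
    (fun x y hxy => by
      rw [dist_pi_le_iff hη.le]
      intro s
      exact hfε _ _ (h4 x y hxy s s.2))
  refine ⟨g, hg1, fun x s => (dist_le_pi_dist (g x) _ s).trans (hg2 x), fun x y h => 
    h4 x y (hg3 x y h)⟩

theorem density {G X Y : Type*} [Group G] [MetricSpace X] [CompactSpace X] [Nonempty X]
    [TopologicalSpace Y] (m : ℕ)
    (Fseq : ℕ → Finset G) (hFseq : IsFolnerSeq Fseq)
    (α : GAction G X) (hα : ∀ g, Continuous (α.act g))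
    (β : GAction G Y) (hβ : ∀ g, Continuous (β.act g)) (hAF : IsAlmostFinite β)
    (π : X → Y) (hπ : Continuous π)
    (hπe : ∀ g x, π (α.act g x) = β.act g (π x))
    (hmdim : mdim α dist Fseq < (m : ℝ≥0∞) / 2) (f : C(X, Fin m → ℝ)) (η : ℝ) (hη : 0 < η)
    (κ : ℝ) (hκ : 0 < κ) :
    ∃ F : C(X, Fin m → ℝ), dist F f ≤ 3 * η ∧
      ∀ x y, π x = π y → (∀ g, F (α.act g x) = F (α.act g y)) → dist x y < κ := by
  classical
  have huc := CompactSpace.uniformContinuous_of_continuous f.continuous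
  obtain ⟨ε', hε', hfε'⟩ := Metric.uniformContinuous_iff.1 huc η hη
  set ε := min (ε' / 2) (κ / 2) with hε
  have hεpos : 0 < ε := by positivity
  have hfε : ∀ x y, dist x y ≤ ε → dist (f x) (f y) ≤ η := fun x y h => 
    (hfε' (lt_of_le_of_lt (h.trans (min_le_left _ _)) (by linarith))).le
  obtain ⟨K, δ, hδ, hK⟩ := exists_inv hα m Fseq hFseq hmdim hεpos
  obtain ⟨ι, _, W, S, hW, hS, hdisj, hcov⟩ := hAF K δ hδ
  have htower : ∀ i, ∃ g : X → S i → Fin m → ℝ, Continuous g ∧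
      (∀ x (s : S i), dist (g x s) (f (α.act s x)) ≤ 3 * η) ∧
      ∀ x y, g x = g y → ∀ s ∈ S i, dist (α.act s x) (α.act s y) ≤ ε := by
    intro i
    obtain ⟨n, hn1, hn2⟩ := hK (S i) (hS i).1 (hS i).2
    exact tower_map hα hη (S i) hn1 hn2 f f.continuous hfε
  choose g hg1 hg2 hg3 using htower
  let P : (Σ i, S i) → Set X := fun p => π ⁻¹' (β.act p.2 '' W p.1)
  have himg : ∀ s (A : Set Y), β.act s '' A = β.act s⁻¹ ⁻¹' A := by
    intro s A
    refine congrFun (Set.image_eq_preimage_of_inverse ?_ ?_) A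
    · intro y; rw [← β.act_mul, inv_mul_cancel, β.act_one]
    · intro y; rw [← β.act_mul, mul_inv_cancel, β.act_one]
  have hPmem : ∀ p x, x ∈ P p ↔ β.act (p.2 : G)⁻¹ (π x) ∈ W p.1 := by
    intro p x
    simp only [P, himg, Set.mem_preimage]
  have hPc : ∀ p, IsClopen (P p) := by
    intro p
    have : P p = (fun x => β.act (p.2 : G)⁻¹ (π x)) ⁻¹' W p.1 := by
      ext x; exact hPmem p x
    rw [this]
    exact (hW p.1).preimage ((hβ _).comp hπ)
  have hPd : ∀ p q x, x ∈ P p → x ∈ P q → p = q := by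
    rintro ⟨i, s⟩ ⟨j, t⟩ x hp hq
    by_contra hne
    have := hdisj i j s s.2 t t.2 (by
      rintro ⟨rfl, hst⟩
      exact hne (by rw [Subtype.ext hst]))
    exact Set.disjoint_left.1 this hp hq
  have hPcov : ∀ x, ∃ p, x ∈ P p := by
    intro x
    have : π x ∈ ⋃ i, ⋃ s ∈ S i, β.act s '' W i := by rw [hcov]; trivial
    simp only [Set.mem_iUnion] at this
    obtain ⟨i, s, hs, h⟩ := this
    exact ⟨⟨i, ⟨s, hs⟩⟩, h⟩
  let F : X → Fin m → ℝ := fun x =>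
    ∑ p, (P p).indicator (fun x => g p.1 (α.act (p.2 : G)⁻¹ x) p.2) x
  have hF : Continuous F := by
    refine continuous_finsetSum _ fun p _ => ?_
    refine (hPc p).continuous_indicator ?_
    exact (continuous_apply p.2).comp ((hg1 p.1).comp (hα _))
  have hFp : ∀ p x, x ∈ P p → F x = g p.1 (α.act (p.2 : G)⁻¹ x) p.2 := by
    intro p x hx
    simp only [F]
    rw [Finset.sum_eq_single p]
    · rw [Set.indicator_of_mem hx]
    · intro q _ hq
      rw [Set.indicator_of_notMem]
      intro hxq
      exact hq (hPd q p x hxq hx)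
    · simp
  refine ⟨⟨F, hF⟩, ?_, ?_⟩
  · rw [ContinuousMap.dist_le (by positivity)]
    intro x
    obtain ⟨p, hp⟩ := hPcov x
    have h1 := hg2 p.1 (α.act (p.2 : G)⁻¹ x) p.2
    rw [← α.act_mul, mul_inv_cancel, α.act_one] at h1
    simp only [ContinuousMap.coe_mk]
    rw [hFp p x hp]
    exact h1
  · intro x y hxy hF
    obtain ⟨⟨i, s⟩, hp⟩ := hPcov x
    set z := α.act (s : G)⁻¹ x with hz
    set z' := α.act (s : G)⁻¹ y with hz'
    have hzW : π z ∈ W i := by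
      rw [hz, hπe]; exact (hPmem ⟨i, s⟩ x).1 hp
    have hzW' : π z' ∈ W i := by
      rw [hz', hπe, ← hxy, ← hπe]; exact hzW
    have hval : ∀ w, π w ∈ W i → ∀ t : S i, F (α.act t w) = g i w t := by
      intro w hw t
      have hmem : α.act t w ∈ P ⟨i, t⟩ := by
        rw [hPmem, hπe, ← β.act_mul]
        simpa [β.act_one] using hw
      have := hFp ⟨i, t⟩ _ hmem
      rw [← α.act_mul] at this
      simpa [α.act_one] using this
    have hgz : g i z = g i z' := by
      funext t
      rw [← hval z hzW t, ← hval z' hzW' t, hz, hz', ← α.act_mul, ← α.act_mul]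
      exact hF _
    have := hg3 i z z' hgz s s.2
    rw [hz, hz', ← α.act_mul, ← α.act_mul, mul_inv_cancel, α.act_one, α.act_one] at this
    refine this.trans_lt (lt_of_le_of_lt (min_le_right _ _) (by linarith))

theorem exists_inj_real (Y : Type*) [TopologicalSpace Y] [CompactSpace Y]
    [TopologicalSpace.MetrizableSpace Y] [TotallyDisconnectedSpace Y] :
    ∃ c : Y → ℝ, Continuous c ∧ Function.Injective c := by
  classical
  letI := TopologicalSpace.metrizableSpaceMetric Y
  haveI : SecondCountableTopology Y := inferInstance
  haveI : Countable (TopologicalSpace.Clopens Y) :=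
    TopologicalSpace.Clopens.countable_iff_secondCountable.2 inferInstance
  haveI : Nonempty (TopologicalSpace.Clopens Y) := ⟨⊤⟩
  obtain ⟨U, hU⟩ := exists_surjective_nat (TopologicalSpace.Clopens Y)
  let b : Y → ℕ → Bool := fun y n => decide (y ∈ U n)
  refine ⟨fun y => Cardinal.cantorFunction (1 / 3) (b y), ?_, ?_⟩
  · unfold Cardinal.cantorFunction
    refine continuous_tsum (u := fun n => (1 / 3 : ℝ) ^ n) ?_
      (summable_geometric_of_lt_one (by norm_num) (by norm_num)) ?_
    · intro n
      have : (fun y => Cardinal.cantorFunctionAux (1 / 3) (b y) n) =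
          (U n : Set Y).indicator (fun _ => (1 / 3 : ℝ) ^ n) := by
        funext y
        by_cases hy : y ∈ U n
        · rw [Set.indicator_of_mem (by exact hy),
            Cardinal.cantorFunctionAux_true (by simpa [b] using hy)]
        · rw [Set.indicator_of_notMem (by exact hy),
            Cardinal.cantorFunctionAux_false (by simpa [b] using hy)]
      rw [this]
      exact (U n).isClopen.continuous_indicator continuous_const
    · intro n y
      cases h : b y n
      · rw [Cardinal.cantorFunctionAux_false h]; simp
      · rw [Cardinal.cantorFunctionAux_true h]; simp
  · intro x y hxy
    have h1 := Cardinal.cantorFunction_injective (by norm_num) (by norm_num) hxy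
    by_contra hne
    obtain ⟨A, hA, hxA, hyA⟩ := exists_isClopen_of_totally_separated hne
    obtain ⟨n, hn⟩ := hU ⟨A, hA⟩
    have h2 := congrFun h1 n
    simp only [b, hn, decide_eq_decide] at h2
    exact hyA (h2.1 hxA)

theorem exists_inj_unit : ∃ c : ℝ → unitInterval, Continuous c ∧ Function.Injective c := by
  refine ⟨fun x => ⟨Real.sigmoid x, Real.sigmoid_nonneg x, Real.sigmoid_le_one x⟩, ?_, ?_⟩
  · exact Continuous.subtype_mk continuous_sigmoid _
  · intro x y h
    exact Real.sigmoid_injective (Subtype.mk.inj h)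

theorem baire_part {G X Y : Type*} [Group G] [MetricSpace X] [CompactSpace X] [Nonempty X]
    [TopologicalSpace Y] [T2Space Y] (m : ℕ)
    (Fseq : ℕ → Finset G) (hFseq : IsFolnerSeq Fseq)
    (α : GAction G X) (hα : ∀ g, Continuous (α.act g))
    (β : GAction G Y) (hβ : ∀ g, Continuous (β.act g)) (hAF : IsAlmostFinite β)
    (π : X → Y) (hπ : Continuous π)
    (hπe : ∀ g x, π (α.act g x) = β.act g (π x))
    (hmdim : mdim α dist Fseq < (m : ℝ≥0∞) / 2) :
    ∃ F : C(X, Fin m → ℝ), ∀ x y, π x = π y → (∀ g, F (α.act g x) = F (α.act g y)) → x = y := by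
  let O : ℕ → Set C(X, Fin m → ℝ) := fun k =>
    {F | ∀ x y, π x = π y → (∀ g, F (α.act g x) = F (α.act g y)) → dist x y < 1 / (k + 1)}
  have hopen : ∀ k, IsOpen (O k) := by
    intro k
    let Z : Set (C(X, Fin m → ℝ) × (X × X)) := {q | π q.2.1 = π q.2.2 ∧
      (∀ g, q.1 (α.act g q.2.1) = q.1 (α.act g q.2.2)) ∧ 1 / ((k : ℝ) + 1) ≤ dist q.2.1 q.2.2}
    have hZ1 : IsClosed {q : C(X, Fin m → ℝ) × (X × X) | π q.2.1 = π q.2.2} :=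
      isClosed_eq (by fun_prop) (by fun_prop)
    have hZ2 : IsClosed {q : C(X, Fin m → ℝ) × (X × X) |
        ∀ g, q.1 (α.act g q.2.1) = q.1 (α.act g q.2.2)} := by
      have : {q : C(X, Fin m → ℝ) × (X × X) | ∀ g, q.1 (α.act g q.2.1) = q.1 (α.act g q.2.2)} =
          ⋂ g, {q | q.1 (α.act g q.2.1) = q.1 (α.act g q.2.2)} := by
        ext q; simp
      rw [this]
      refine isClosed_iInter fun g => ?_
      have := hα g
      exact isClosed_eq (by fun_prop) (by fun_prop)
    have hZ3 : IsClosed {q : C(X, Fin m → ℝ) × (X × X) |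
        1 / ((k : ℝ) + 1) ≤ dist q.2.1 q.2.2} :=
      isClosed_le (by fun_prop) (by fun_prop)
    have hZ : IsClosed Z := hZ1.inter (hZ2.inter hZ3)
    have h1 := isClosedMap_fst_of_compactSpace (X := C(X, Fin m → ℝ)) (Y := X × X) Z hZ
    have : O k = (Prod.fst '' Z)ᶜ := by
      ext F
      simp only [O, Z, Set.mem_ofPred_eq, Set.mem_compl_iff, Set.mem_image, not_exists, not_and]
      constructor
      · rintro h ⟨F', x, y⟩ ⟨h1, h2, h3⟩ rfl
        exact absurd (h x y h1 h2) (not_lt.2 h3)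
      · intro h x y h1 h2
        by_contra h3
        exact h (F, (x, y)) ⟨h1, h2, not_lt.1 h3⟩ rfl
    rw [this]
    exact h1.isOpen_compl
  have hdense : ∀ k, Dense (O k) := by
    intro k
    rw [Metric.dense_iff]
    intro f r hr
    obtain ⟨F, hF1, hF2⟩ := density m Fseq hFseq α hα β hβ hAF π hπ hπe hmdim f (r / 4)
      (by positivity) (1 / (k + 1)) (by positivity)
    exact ⟨F, by rw [Metric.mem_ball]; linarith, hF2⟩
  obtain ⟨F, hF⟩ := (dense_iInter_of_isOpen hopen hdense).nonempty
  rw [Set.mem_iInter] at hF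
  refine ⟨F, fun x y h1 h2 => ?_⟩
  by_contra hne
  obtain ⟨k, hk⟩ := exists_nat_one_div_lt (dist_pos.2 hne)
  exact absurd (hF k x y h1 h2) (not_lt.2 hk.le)

theorem stmt15 {G X Y : Type*} [Group G] [Countable G] [MetricSpace X] [CompactSpace X]
    [TopologicalSpace Y] [CompactSpace Y] [TopologicalSpace.MetrizableSpace Y]
    [TotallyDisconnectedSpace Y] (m : ℕ) (hm : 1 ≤ m)
    (Fseq : ℕ → Finset G) (hFseq : IsFolnerSeq Fseq)
    (α : GAction G X) (hα : ∀ g, Continuous (α.act g))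
    (β : GAction G Y) (hβ : ∀ g, Continuous (β.act g)) (hAF : IsAlmostFinite β)
    (π : X → Y) (hπ : Continuous π) (hπs : Function.Surjective π)
    (hπe : ∀ g x, π (α.act g x) = β.act g (π x))
    (hmdim : mdim α dist Fseq < (m : ℝ≥0∞) / 2) :
    ∃ Φ : X → G → Fin (m + 1) → unitInterval, Continuous Φ ∧ Function.Injective Φ ∧
      ∀ (g : G) (x : X) (h : G), Φ (α.act g x) h = Φ x (g⁻¹ * h) := by
  cases isEmpty_or_nonempty X with
  | inl hX =>
    exact ⟨fun x => hX.elim x, continuous_of_const fun x => hX.elim x, fun x => hX.elim x,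
      fun _ x => hX.elim x⟩
  | inr hX =>
    obtain ⟨F, hF⟩ := baire_part m Fseq hFseq α hα β hβ hAF π hπ hπe hmdim
    obtain ⟨c, hc, hci⟩ := exists_inj_real Y
    obtain ⟨u, hu, hui⟩ := exists_inj_unit
    let f : X → Fin (m + 1) → unitInterval := fun x =>
      Fin.cons (u (c (π x))) (fun i => u (F x i))
    have hf : Continuous f := by
      refine continuous_pi fun i => ?_
      refine Fin.cases ?_ (fun i => ?_) i
      · simp only [f, Fin.cons_zero]
        exact hu.comp (hc.comp hπ)
      · simp only [f, Fin.cons_succ]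
        exact hu.comp ((continuous_apply i).comp F.continuous)
    refine ⟨fun x h => f (α.act h⁻¹ x), ?_, ?_, ?_⟩
    · exact continuous_pi fun h => hf.comp (hα _)
    · intro x y hxy
      have hfe : ∀ g, f (α.act g x) = f (α.act g y) := by
        intro g
        have := congrFun hxy g⁻¹
        simpa using this
      apply hF
      · have := congrFun (hfe 1) 0
        simp only [f, Fin.cons_zero, α.act_one] at this
        exact hci (hui this)
      · intro g
        funext i
        have := congrFun (hfe g) i.succ
        simp only [f, Fin.cons_succ] at this
        exact hui this
    · intro g x h
      simp only [← α.act_mul, mul_inv_rev, inv_inv]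
end
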